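/- arXiv:0803.3747 — 9 statements merged into one kernel-verified Lean document; each statement's English description precedes it below -/
import Mathlib

section
/- Let a = X x for some x : σ and let u ∈ H satisfy ε(u) = 0. Then for every integer k > 1, the iterated reduced coproduct satisfies the recursion Δ̄ᵏ(a·u) = a ⊗ Δ̄ᵏ⁻¹u + Σ (a·u⁽¹⁾) ⊗ Δ̄ᵏ⁻¹(u⁽²⁾) + Σ u⁽¹⁾ ⊗ Δ̄ᵏ⁻¹(a·u⁽²⁾), where Δ̄u = Σ u⁽¹⁾ ⊗ u⁽²⁾. -/
/-! Statement 1: recursion for the iterated reduced coproduct of `a·u`. -/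

open MvPolynomial TensorProduct

noncomputable section

abbrev H (σ : Type) := MvPolynomial σ ℚ

/-- Model of the `k`-fold tensor power `H^{⊗k}`: the `i`-th tensor factor
corresponds to the variables `X (x, i)`. -/
abbrev Hpow (σ : Type) (k : ℕ) := MvPolynomial (σ × Fin k) ℚ

/-- The iterated coproduct `Δ^{k-1} : H → H^{⊗k}` (with `k` tensor factors),
i.e. the algebra map sending each `X x` to the sum of its copies in the `k` slots.
For `k = 2` this is the coproduct `Δ(X x) = X x ⊗ 1 + 1 ⊗ X x`. -/
def DIter (σ : Type) (k : ℕ) : H σ →ₐ[ℚ] Hpow σ k :=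
  aeval fun x => ∑ i : Fin k, X (x, i)

/-- Setting to `0` all variables lying in the slots of `S`; used to express the
projection `π = id - 1∘ε` on each tensor factor by inclusion–exclusion. -/
def zeroSlots (σ : Type) (k : ℕ) (S : Finset (Fin k)) : Hpow σ k →ₐ[ℚ] Hpow σ k :=
  aeval fun p => if p.2 ∈ S then 0 else X p

/-- The iterated reduced coproduct `Δ̄^{k-1} : H → H^{⊗k}` (with `k` tensor
factors): `Δ̄^{k-1} = π^{⊗k} ∘ Δ^{k-1}` where `π = id - 1∘ε`, written by
inclusion–exclusion.  On the augmentation ideal `ker ε` (where all our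
statements take place) this agrees with the recursively iterated reduced
coproduct `Δ̄u = Δu - 1 ⊗ u - u ⊗ 1`, `Δ̄ᵏ⁺¹ = (id^{⊗k} ⊗ Δ̄) ∘ Δ̄ᵏ`. -/
def DbarIter (σ : Type) (k : ℕ) : H σ →ₗ[ℚ] Hpow σ k :=
  (∑ S : Finset (Fin k), ((-1 : ℚ)) ^ S.card • (zeroSlots σ k S).toLinearMap) ∘ₗ
    (DIter σ k).toLinearMap

/-- The binary coproduct `Δ : H → H ⊗ H` (genuine tensor product). -/
def Delta (σ : Type) : H σ →ₐ[ℚ] (H σ) ⊗[ℚ] (H σ) :=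
  aeval fun x => X x ⊗ₜ[ℚ] 1 + 1 ⊗ₜ[ℚ] X x

/-- The binary reduced coproduct `Δ̄ u = Δ u - 1 ⊗ u - u ⊗ 1`. -/
def Dbar (σ : Type) : H σ →ₗ[ℚ] (H σ) ⊗[ℚ] (H σ) :=
  (Delta σ).toLinearMap - TensorProduct.mk ℚ (H σ) (H σ) 1
    - (TensorProduct.mk ℚ (H σ) (H σ)).flip 1

/-- Shifting a `k`-fold tensor into the last `k` slots of a `(k+1)`-fold tensor. -/
def shiftS (σ : Type) (k : ℕ) : Hpow σ k →ₐ[ℚ] Hpow σ (k + 1) :=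
  rename (Prod.map id Fin.succ)

/-- The canonical identification `H ⊗ H^{⊗k} ≃ H^{⊗(k+1)}`:
`v ⊗ w ↦ (v in slot 0) * (w shifted to slots 1..k)`. -/
def glue (σ : Type) (k : ℕ) : (H σ) ⊗[ℚ] (Hpow σ k) →ₗ[ℚ] Hpow σ (k + 1) :=
  TensorProduct.lift ((LinearMap.mul ℚ (Hpow σ (k + 1))).compl₁₂
    ((rename (fun x : σ => (x, (0 : Fin (k + 1)))) : H σ →ₐ[ℚ] Hpow σ (k + 1)).toLinearMap)
    (shiftS σ k).toLinearMap)

/-- The augmentation `1 ∘ ε`, as an algebra endomorphism of `H σ`. -/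
def augmentation (σ : Type) : H σ →ₐ[ℚ] H σ :=
  aeval fun _ => 0

/-- The multiplicative version of `glue`. -/
def glueAlgHom (σ : Type) (k : ℕ) : (H σ) ⊗[ℚ] (Hpow σ k) →ₐ[ℚ] Hpow σ (k + 1) :=
  Algebra.TensorProduct.productMap (rename (fun x : σ => (x, (0 : Fin (k + 1))))) (shiftS σ k)

theorem glue_apply (σ : Type) (k : ℕ) (t : (H σ) ⊗[ℚ] (Hpow σ k)) :
    glue σ k t = glueAlgHom σ k t := by
  induction t using TensorProduct.induction_on with
  | zero => simp
  | tmul a b => simp [glue, glueAlgHom]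
  | add a b ha hb => rw [map_add, map_add, ha, hb]

theorem glue_tmul (σ : Type) (k : ℕ) (v : H σ) (w : Hpow σ k) :
    glue σ k (v ⊗ₜ w) = rename (fun x : σ => (x, (0 : Fin (k + 1)))) v * shiftS σ k w := by
  simp [glue]

theorem augmentation_apply (σ : Type) (u : H σ) :
    augmentation σ u = C (constantCoeff u) := by
  exact aeval_zero' u

theorem Delta_X (σ : Type) (x : σ) :
    Delta σ (X x) = X x ⊗ₜ[ℚ] 1 + 1 ⊗ₜ[ℚ] X x := by
  simp [Delta]

theorem zeroSlots_map_succ (σ : Type) (k : ℕ) (S : Finset (Fin k)) (v : H σ) :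
    zeroSlots σ (k + 1) (S.map (Fin.succEmb k)) (DIter σ (k + 1) v) =
      glue σ k (TensorProduct.map LinearMap.id
        ((zeroSlots σ k S).toLinearMap ∘ₗ (DIter σ k).toLinearMap) (Delta σ v)) := by
  have h : (zeroSlots σ (k + 1) (S.map (Fin.succEmb k))).comp (DIter σ (k + 1)) =
      ((glueAlgHom σ k).comp (Algebra.TensorProduct.map (AlgHom.id ℚ (H σ))
        ((zeroSlots σ k S).comp (DIter σ k)))).comp (Delta σ) := by
    ext1 y
    simp [zeroSlots, DIter, Delta_X, glueAlgHom, shiftS, Fin.sum_univ_succ, apply_ite]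
  rw [glue_apply]
  exact DFunLike.congr_fun h v

theorem zeroSlots_insert_zero (σ : Type) (k : ℕ) (S : Finset (Fin k)) (v : H σ) :
    zeroSlots σ (k + 1) (insert 0 (S.map (Fin.succEmb k))) (DIter σ (k + 1) v) =
      glue σ k (TensorProduct.map (augmentation σ).toLinearMap
        ((zeroSlots σ k S).toLinearMap ∘ₗ (DIter σ k).toLinearMap) (Delta σ v)) := by
  have h : (zeroSlots σ (k + 1) (insert 0 (S.map (Fin.succEmb k)))).comp (DIter σ (k + 1)) =
      ((glueAlgHom σ k).comp (Algebra.TensorProduct.map (augmentation σ)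
        ((zeroSlots σ k S).comp (DIter σ k)))).comp (Delta σ) := by
    ext1 y
    simp [zeroSlots, DIter, Delta_X, glueAlgHom, shiftS, Fin.sum_univ_succ, apply_ite,
      augmentation]
  rw [glue_apply]
  exact DFunLike.congr_fun h v

theorem sum_finset_fin_succ {M : Type*} [AddCommMonoid M] (k : ℕ) (f : Finset (Fin (k + 1)) → M) :
    ∑ S, f S = ∑ S : Finset (Fin k),
      (f (S.map (Fin.succEmb k)) + f (insert 0 (S.map (Fin.succEmb k)))) := by
  have h0 : (0 : Fin (k + 1)) ∉ Finset.univ.map (Fin.succEmb k) := by simp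
  have hu : (Finset.univ : Finset (Fin (k + 1))) =
      insert 0 (Finset.univ.map (Fin.succEmb k)) := by
    ext i; cases i using Fin.cases <;> simp
  have hp : (Finset.univ.map (Fin.succEmb k)).powerset =
      Finset.univ.map (Finset.mapEmbedding (Fin.succEmb k)).toEmbedding := by
    ext S
    simp [Finset.subset_map_iff, eq_comm]
  rw [← Finset.powerset_univ, hu, Finset.sum_powerset_insert h0, hp, Finset.sum_map,
    Finset.sum_map, Finset.sum_add_distrib]
  simp

theorem tensorProduct_map_sub_left {R M N P Q : Type*} [CommRing R] [AddCommGroup M]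
    [AddCommGroup N] [AddCommGroup P] [AddCommGroup Q] [Module R M] [Module R N] [Module R P]
    [Module R Q] (f₁ f₂ : M →ₗ[R] P) (g : N →ₗ[R] Q) :
    TensorProduct.map (f₁ - f₂) g = TensorProduct.map f₁ g - TensorProduct.map f₂ g :=
  LinearMap.map_sub₂ (TensorProduct.mapBilinear (RingHom.id R) M N P Q) f₁ f₂ g

/-- `Δ̄ᵏ = (π ⊗ Δ̄ᵏ⁻¹) ∘ Δ`, where `π = id - 1 ∘ ε`. -/
theorem DbarIter_succ (σ : Type) (k : ℕ) (v : H σ) :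
    DbarIter σ (k + 1) v =
      glue σ k (TensorProduct.map (LinearMap.id - (augmentation σ).toLinearMap)
        (DbarIter σ k) (Delta σ v)) := by
  have hr : DbarIter σ k = ∑ S : Finset (Fin k), ((-1 : ℚ)) ^ S.card •
      ((zeroSlots σ k S).toLinearMap ∘ₗ (DIter σ k).toLinearMap) := by
    refine LinearMap.ext fun w => ?_
    simp [DbarIter]
  have hc (S : Finset (Fin k)) : (insert 0 (S.map (Fin.succEmb k))).card = S.card + 1 := by
    rw [Finset.card_insert_of_notMem (by simp), Finset.card_map]
  have hl : DbarIter σ (k + 1) v = ∑ S : Finset (Fin (k + 1)), ((-1 : ℚ)) ^ S.card •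
      zeroSlots σ (k + 1) S (DIter σ (k + 1) v) := by
    simp [DbarIter]
  have hm (f : H σ →ₗ[ℚ] H σ) : TensorProduct.map f (DbarIter σ k) =
      ∑ S : Finset (Fin k), ((-1 : ℚ)) ^ S.card • TensorProduct.map f
        ((zeroSlots σ k S).toLinearMap ∘ₗ (DIter σ k).toLinearMap) := by
    rw [hr, ← TensorProduct.mapBilinear_apply, map_sum]
    simp
  rw [hl, sum_finset_fin_succ, hm, LinearMap.sum_apply, map_sum]
  refine Finset.sum_congr rfl fun S _ => ?_
  rw [zeroSlots_map_succ, zeroSlots_insert_zero, hc, Finset.card_map, tensorProduct_map_sub_left]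
  simp only [LinearMap.smul_apply, LinearMap.sub_apply, map_smul, map_sub, pow_succ]
  module

theorem DbarIter_one (σ : Type) (k : ℕ) (hk : 0 < k) : DbarIter σ k 1 = 0 := by
  obtain ⟨k, rfl⟩ := Nat.exists_eq_add_of_lt hk
  rw [zero_add, DbarIter_succ]
  simp [Algebra.TensorProduct.one_def]

theorem DbarIter_X (σ : Type) (k : ℕ) (hk : 1 < k) (x : σ) : DbarIter σ k (X x) = 0 := by
  obtain ⟨k, rfl⟩ := Nat.exists_eq_add_of_lt hk
  rw [DbarIter_succ, Delta_X]
  simp [DbarIter_one]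

theorem map_augmentation_Delta (σ : Type) (u : H σ) :
    TensorProduct.map (augmentation σ).toLinearMap LinearMap.id (Delta σ u) = 1 ⊗ₜ u := by
  have h : (Algebra.TensorProduct.map (augmentation σ) (AlgHom.id ℚ (H σ))).comp (Delta σ) =
      Algebra.TensorProduct.includeRight := by
    ext1 y
    simp [Delta_X, augmentation]
  exact DFunLike.congr_fun h u

theorem Delta_eq (σ : Type) (u : H σ) : Delta σ u = Dbar σ u + 1 ⊗ₜ u + u ⊗ₜ 1 := by
  simp only [Dbar, LinearMap.sub_apply, AlgHom.toLinearMap_apply, mk_apply, LinearMap.flip_apply]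
  abel

theorem map_augmentation_Dbar (σ : Type) {u : H σ} (hu : constantCoeff u = 0) :
    TensorProduct.map (augmentation σ).toLinearMap LinearMap.id (Dbar σ u) = 0 := by
  have h := map_augmentation_Delta σ u
  rw [Delta_eq] at h
  simpa [augmentation_apply, hu] using h

theorem Delta_X_mul (σ : Type) (x : σ) (u : H σ) :
    Delta σ (X x * u) =
      TensorProduct.map (LinearMap.mulLeft ℚ (X x)) LinearMap.id (Delta σ u) +
        TensorProduct.map LinearMap.id (LinearMap.mulLeft ℚ (X x)) (Delta σ u) := by
  rw [map_mul, Delta_X]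
  induction Delta σ u using TensorProduct.induction_on with
  | zero => simp
  | tmul a b => simp [add_mul]
  | add a b ha hb => rw [mul_add, ha, hb]; simp only [map_add]; abel

/-- Lemma 3.1 (second part): for `a = X x`, `ε(u) = 0` and `k > 1`,
`Δ̄ᵏ(a·u) = a ⊗ Δ̄ᵏ⁻¹u + Σ (a·u⁽¹⁾) ⊗ Δ̄ᵏ⁻¹(u⁽²⁾) + Σ u⁽¹⁾ ⊗ Δ̄ᵏ⁻¹(a·u⁽²⁾)`,
where `Δ̄u = Σ u⁽¹⁾ ⊗ u⁽²⁾`.  Here `Δ̄ᵏ` (with `k+1` tensor factors) is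
`DbarIter σ (k+1)`, and the Sweedler sums are expressed by applying the
appropriate maps to the two factors of `Δ̄u` and gluing. -/
theorem stmt1 (σ : Type) (x : σ) (u : H σ) (hu : constantCoeff u = 0)
    (k : ℕ) (hk : 1 < k) :
    DbarIter σ (k + 1) (X x * u) =
      X (x, (0 : Fin (k + 1))) * shiftS σ k (DbarIter σ k u)
        + glue σ k ((TensorProduct.map (LinearMap.mulLeft ℚ (X x)) (DbarIter σ k))
            (Dbar σ u))
        + glue σ k ((TensorProduct.map LinearMap.id
            ((DbarIter σ k) ∘ₗ LinearMap.mulLeft ℚ (X x))) (Dbar σ u)) := by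
  have h_first : (LinearMap.id - (augmentation σ).toLinearMap) ∘ₗ LinearMap.mulLeft ℚ (X x) =
      LinearMap.mulLeft ℚ (X x) := by
    refine LinearMap.ext fun v => ?_
    simp [augmentation_apply]
  have h_second : TensorProduct.map (LinearMap.id - (augmentation σ).toLinearMap)
      (DbarIter σ k ∘ₗ LinearMap.mulLeft ℚ (X x)) (Dbar σ u) =
      TensorProduct.map LinearMap.id (DbarIter σ k ∘ₗ LinearMap.mulLeft ℚ (X x)) (Dbar σ u) := by
    have h : TensorProduct.map (augmentation σ).toLinearMap
        (DbarIter σ k ∘ₗ LinearMap.mulLeft ℚ (X x)) (Dbar σ u) = 0 := by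
      rw [← LinearMap.id_comp (augmentation σ).toLinearMap,
        ← LinearMap.comp_id (DbarIter σ k ∘ₗ LinearMap.mulLeft ℚ (X x)), TensorProduct.map_comp,
        LinearMap.comp_apply, map_augmentation_Dbar σ hu, map_zero]
    rw [tensorProduct_map_sub_left, LinearMap.sub_apply, h, sub_zero]
  have h_one : DbarIter σ k 1 = 0 := DbarIter_one σ k (by omega)
  have h_X : DbarIter σ k (X x) = 0 := DbarIter_X σ k hk x
  rw [DbarIter_succ, Delta_X_mul, map_add, ← LinearMap.comp_apply, ← LinearMap.comp_apply,
    ← TensorProduct.map_comp, ← TensorProduct.map_comp, LinearMap.comp_id, LinearMap.comp_id,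
    h_first, Delta_eq]
  simp only [map_add, h_second]
  simp only [TensorProduct.map_tmul, glue_tmul, LinearMap.comp_apply, LinearMap.mulLeft_apply,
    mul_one, h_one, h_X, map_zero, mul_zero, LinearMap.sub_apply, LinearMap.id_apply,
    AlgHom.toLinearMap_apply, map_one, sub_self, zero_mul, rename_X]
  abel

end
end

section
/- Let u ∈ H satisfy ε(u) = 0 and let v ∈ H. Then for every integer k ≥ 1, the iterated coproduct of the product u·v satisfies Δᵏ⁻¹(u·v) = Σ_{p=1}^{k} Σ_{1 ≤ i₁ < ⋯ < i_p ≤ k} Σ v₍₁₎ ⊗ ⋯ ⊗ (u⁽¹⁾·v₍ᵢ₁₎) ⊗ ⋯ ⊗ (u⁽ᵖ⁾·v₍ᵢₚ₎) ⊗ ⋯ ⊗ v₍ₖ₎, where Δᵏ⁻¹v = Σ v₍₁₎ ⊗ ⋯ ⊗ v₍ₖ₎, Δ̄ᵖ⁻¹u = Σ u⁽¹⁾ ⊗ ⋯ ⊗ u⁽ᵖ⁾, and in each summand the factor u⁽ʲ⁾ is multiplied into the i_j-th tensor slot of Δᵏ⁻¹v. -/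
/-! Statement 3: iterated coproduct of a product `u·v`. -/

open MvPolynomial TensorProduct

noncomputable section

/-- The algebra map sending each `X x` to the sum of its copies in the slots of `T`. -/
def slotSum (σ : Type) (k : ℕ) (T : Finset (Fin k)) : H σ →ₐ[ℚ] Hpow σ k :=
  aeval fun x => ∑ i ∈ T, X (x, i)

theorem slotSum_univ (σ : Type) (k : ℕ) : slotSum σ k Finset.univ = DIter σ k := rfl

theorem rename_zeroSlots_DIter (σ : Type) {m k : ℕ} (e : Fin m ↪ Fin k)
    (A : Finset (Fin m)) (u : H σ) :
    rename (fun p : σ × Fin m => (p.1, e p.2)) (zeroSlots σ m A (DIter σ m u)) =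
      slotSum σ k (Finset.univ.map e \ A.map e) u := by
  have h : ((rename (R := ℚ) (fun p : σ × Fin m => (p.1, e p.2))).comp
      (zeroSlots σ m A)).comp (DIter σ m) =
      slotSum σ k (Finset.univ.map e \ A.map e) := by
    apply MvPolynomial.algHom_ext
    intro x
    rw [← Finset.map_sdiff]
    simp [zeroSlots, DIter, slotSum, Finset.sum_ite, Finset.sdiff_eq_filter]
  exact DFunLike.congr_fun h u

theorem rename_DbarIter (σ : Type) {k : ℕ} (S : Finset (Fin k)) (u : H σ) :
    rename (fun p : σ × Fin S.card => (p.1, S.orderEmbOfFin rfl p.2))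
        (DbarIter σ S.card u) =
      ∑ T ∈ S.powerset, (-1 : ℚ) ^ T.card • slotSum σ k (S \ T) u := by
  set e := (S.orderEmbOfFin rfl).toEmbedding with he
  have hS : Finset.univ.map e = S := S.map_orderEmbOfFin_univ rfl
  have hP : S.powerset = Finset.univ.map (Finset.mapEmbedding e).toEmbedding := by
    ext T
    rw [Finset.mem_powerset]
    nth_rewrite 1 [← hS]
    simp [Finset.subset_map_iff, eq_comm]
  have h := fun A => rename_zeroSlots_DIter σ e A u
  rw [hS] at h
  rw [hP, Finset.sum_map]
  simp only [DbarIter, LinearMap.comp_apply, LinearMap.sum_apply, LinearMap.smul_apply,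
    AlgHom.toLinearMap_apply, map_sum, map_smul]
  refine Finset.sum_congr rfl fun A _ => ?_
  have := h A
  simp only [he, RelEmbedding.coe_toEmbedding] at this
  simp [this, he]

theorem sum_powerset_neg_one_pow_smul_sdiff {α M : Type*} [Fintype α] [DecidableEq α]
    [AddCommGroup M] [Module ℚ M] (f : Finset α → M) :
    ∑ S : Finset α, ∑ T ∈ S.powerset, (-1 : ℚ) ^ T.card • f (S \ T) = f Finset.univ := by
  have h : ∑ S : Finset α, ∑ T ∈ S.powerset, (-1 : ℚ) ^ T.card • f (S \ T) =
      ∑ D : Finset α, ∑ T ∈ Dᶜ.powerset, (-1 : ℚ) ^ T.card • f D := by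
    rw [Finset.sum_sigma', Finset.sum_sigma']
    refine Finset.sum_nbij' (fun p => ⟨p.1 \ p.2, p.2⟩) (fun p => ⟨p.1 ∪ p.2, p.2⟩) ?_ ?_ ?_ ?_ ?_
    · rintro ⟨S, T⟩ -
      simp only [Finset.mem_sigma, Finset.mem_univ, Finset.mem_powerset, true_and]
      intro x hx
      simp [hx]
    · rintro ⟨D, T⟩ -
      simp only [Finset.mem_sigma, Finset.mem_univ, Finset.mem_powerset, true_and]
      exact Finset.subset_union_right
    · rintro ⟨S, T⟩ h
      simp only [Finset.mem_sigma, Finset.mem_univ, Finset.mem_powerset, true_and] at h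
      simp [Finset.sdiff_union_of_subset h]
    · rintro ⟨D, T⟩ h
      simp only [Finset.mem_sigma, Finset.mem_univ, Finset.mem_powerset, true_and] at h
      simp [Finset.union_sdiff_cancel_right (Finset.subset_compl_iff_disjoint_left.mp h)]
    · rintro ⟨S, T⟩ -
      rfl
  have hc (D : Finset α) : ∑ T ∈ Dᶜ.powerset, (-1 : ℚ) ^ T.card =
      if D = Finset.univ then 1 else 0 := by
    have := congrArg (Int.cast : ℤ → ℚ) (Finset.sum_powerset_neg_one_pow_card (x := Dᶜ))
    push_cast at this
    simpa [Finset.compl_eq_empty_iff] using this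
  rw [h]
  simp [← Finset.sum_smul, hc]

/-- Lemma 3.1 (last part): for `ε(u) = 0`, `v ∈ H` and `k ≥ 1`,
`Δᵏ⁻¹(u·v) = Σ_{p=1}^{k} Σ_{1 ≤ i₁ < ⋯ < i_p ≤ k}
  Σ v₍₁₎ ⊗ ⋯ ⊗ (u⁽¹⁾·v₍ᵢ₁₎) ⊗ ⋯ ⊗ (u⁽ᵖ⁾·v₍ᵢₚ₎) ⊗ ⋯ ⊗ v₍ₖ₎`.
In the model `Hpow σ k` of `H^{⊗k}`, the choice of `p` and of the slots
`i₁ < ⋯ < i_p` is a subset `S` of `Fin k` (the empty subset contributing `0`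
since `Δ̄^{-1}u := DbarIter σ 0 u = ε(u) = 0`); placing the `p` factors of
`Δ̄ᵖ⁻¹u` into the slots of `S` in increasing order is the renaming along the
order embedding `Fin S.card ↪ Fin k` of `S`, and multiplying them into the
corresponding factors of `Δᵏ⁻¹v` is multiplication in `Hpow σ k`. -/
theorem stmt3 (σ : Type) (u : H σ) (hu : constantCoeff u = 0) (v : H σ)
    (k : ℕ) (hk : 1 ≤ k) :
    DIter σ k (u * v) =
      ∑ S : Finset (Fin k),
        rename (fun p : σ × Fin S.card => (p.1, S.orderEmbOfFin rfl p.2))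
            (DbarIter σ S.card u)
          * DIter σ k v := by
  rw [← Finset.sum_mul, map_mul]
  simp only [rename_DbarIter]
  rw [sum_powerset_neg_one_pow_smul_sdiff fun T => slotSum σ k T u, slotSum_univ]

end
end

section
/- Let r be an infinitesimal form on H, let a = X x for some x : σ, and let u ∈ H. Then e^{∗r}(a·u) = Σ r(a·u₍₁₎) · e^{∗r}(u₍₂₎), where Δu = Σ u₍₁₎ ⊗ u₍₂₎. -/
/-! Statement 4: `e^{∗r}(a·u) = Σ r(a·u₍₁₎) · e^{∗r}(u₍₂₎)` for `a = X x`. -/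

open MvPolynomial TensorProduct

noncomputable section

/-- A form is a ℚ-linear map `H → ℚ`. -/
abbrev Form (σ : Type) := MvPolynomial σ ℚ →ₗ[ℚ] ℚ

/-- The counit `ε`: the constant-coefficient map (evaluation of all variables at `0`). -/
def counitF (σ : Type) : Form σ :=
  (aeval (R := ℚ) fun _ : σ => (0 : ℚ)).toLinearMap

/-- The convolution product of forms: `(ρ ∗ τ)(u) = Σ ρ(u₍₁₎) τ(u₍₂₎)`. -/
def conv {σ : Type} (ρ τ : Form σ) : Form σ :=
  (TensorProduct.lid ℚ ℚ).toLinearMap ∘ₗ (TensorProduct.map ρ τ) ∘ₗ (Delta σ).toLinearMap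

/-- Convolution powers: `ρ^{∗0} = ε`, `ρ^{∗(n+1)} = ρ^{∗n} ∗ ρ`. -/
def convPow {σ : Type} (ρ : Form σ) : ℕ → Form σ
  | 0 => counitF σ
  | n + 1 => conv (convPow ρ n) ρ

/-- The convolution exponential `e^{∗s} : u ↦ Σ_{n≥0} s^{∗n}(u)/n!`.  On each
`u` the sum is finite since `s^{∗n}(u) = 0` for `n > totalDegree u` when `s` is
infinitesimal; accordingly it is defined as the linear form whose value on the
basis monomial `X^d` (of total degree `Σ d`) is `Σ_{n=0}^{Σ d} s^{∗n}(X^d)/n!`. -/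
def convExp {σ : Type} (s : Form σ) : Form σ :=
  (basisMonomials σ ℚ).constr ℚ fun d =>
    ∑ n ∈ Finset.range ((d.sum fun _ e => e) + 1),
      ((n.factorial : ℚ))⁻¹ * convPow s n (monomial d 1)

/-- The convolution logarithm `log^{∗}ρ : u ↦ Σ_{n≥1} ((-1)^{n+1}/n)·(ρ-ε)^{∗n}(u)`,
a finite sum on each `u` since `(ρ-ε)^{∗n}(u) = 0` for `n > totalDegree u`. -/
def convLog {σ : Type} (ρ : Form σ) : Form σ :=
  (basisMonomials σ ℚ).constr ℚ fun d =>
    ∑ n ∈ Finset.Icc 1 (d.sum fun _ e => e),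
      (((-1 : ℚ)) ^ (n + 1) / n) * convPow (ρ - counitF σ) n (monomial d 1)

section Convolution

variable {σ : Type}

/-- Precomposition of a form with multiplication by `X x`; a derivation for convolution. -/
def mulVar (x : σ) : Form σ →ₗ[ℚ] Form σ :=
  LinearMap.lcomp ℚ ℚ (LinearMap.mulLeft ℚ (X x))

@[simp]
theorem mulVar_apply (x : σ) (ρ : Form σ) (u : H σ) : mulVar x ρ u = ρ (X x * u) := rfl

/-- Convolution as a bilinear map. -/
def convBilin : Form σ →ₗ[ℚ] Form σ →ₗ[ℚ] Form σ :=
  LinearMap.mk₂ ℚ conv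
    (fun _ _ _ => by
      simp [conv, TensorProduct.map_add_left, LinearMap.add_comp, LinearMap.comp_add])
    (fun _ _ _ => by
      simp [conv, TensorProduct.map_smul_left, LinearMap.smul_comp, LinearMap.comp_smul])
    (fun _ _ _ => by
      simp [conv, TensorProduct.map_add_right, LinearMap.add_comp, LinearMap.comp_add])
    (fun _ _ _ => by
      simp [conv, TensorProduct.map_smul_right, LinearMap.smul_comp, LinearMap.comp_smul])

theorem convBilin_apply (ρ τ : Form σ) : convBilin ρ τ = conv ρ τ := rfl

theorem conv_add_left (ρ ρ' τ : Form σ) : conv (ρ + ρ') τ = conv ρ τ + conv ρ' τ := by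
  simp [← convBilin_apply]

theorem conv_add_right (ρ τ τ' : Form σ) : conv ρ (τ + τ') = conv ρ τ + conv ρ τ' := by
  simp [← convBilin_apply]

theorem conv_sub_right (ρ τ τ' : Form σ) : conv ρ (τ - τ') = conv ρ τ - conv ρ τ' := by
  simp [← convBilin_apply]

theorem conv_smul_left (c : ℚ) (ρ τ : Form σ) : conv (c • ρ) τ = c • conv ρ τ := by
  simp [← convBilin_apply]

theorem conv_zero_left (τ : Form σ) : conv 0 τ = 0 := by
  simp [← convBilin_apply]

theorem conv_one (ρ τ : Form σ) : conv ρ τ 1 = ρ 1 * τ 1 := by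
  simp [conv, Algebra.TensorProduct.one_def]

theorem mulVar_conv (x : σ) (ρ τ : Form σ) :
    mulVar x (conv ρ τ) = conv (mulVar x ρ) τ + conv ρ (mulVar x τ) := by
  suffices h : ∀ t : H σ ⊗[ℚ] H σ,
      TensorProduct.lid ℚ ℚ (TensorProduct.map ρ τ
        ((X x ⊗ₜ[ℚ] 1 + 1 ⊗ₜ[ℚ] X x) * t)) =
      TensorProduct.lid ℚ ℚ (TensorProduct.map (mulVar x ρ) τ t) +
        TensorProduct.lid ℚ ℚ (TensorProduct.map ρ (mulVar x τ) t) by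
    refine LinearMap.ext fun u => ?_
    simpa [conv, Delta] using h _
  intro t
  induction t with
  | zero => simp
  | tmul a b => simp [add_mul]
  | add a b ha hb =>
    rw [mul_add]
    simp only [map_add, ha, hb]
    ring

theorem form_ext {ρ τ : Form σ} (h : ∀ d, ρ (monomial d 1) = τ (monomial d 1)) : ρ = τ :=
  (basisMonomials σ ℚ).ext fun d => by simpa using h d

/-- A form vanishes below degree `N` if it kills all monomials of degree less than `N`. -/
def VanishesBelow (N : ℕ) (τ : Form σ) : Prop :=
  ∀ d : σ →₀ ℕ, d.degree < N → τ (monomial d 1) = 0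

theorem X_mul_monomial_one (x : σ) (d : σ →₀ ℕ) :
    (X x * monomial d 1 : H σ) = monomial (Finsupp.single x 1 + d) 1 := by
  simp [X, monomial_mul]

theorem vanishesBelow_succ {N : ℕ} {τ : Form σ} (h₁ : τ 1 = 0)
    (h : ∀ x, VanishesBelow N (mulVar x τ)) : VanishesBelow (N + 1) τ := by
  intro d hd
  rcases eq_or_ne d 0 with rfl | hd₀
  · simpa using h₁
  · obtain ⟨x, hx⟩ := Finsupp.ne_iff.mp hd₀
    obtain ⟨e, rfl⟩ : ∃ e, d = Finsupp.single x 1 + e :=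
      exists_add_of_le (by simpa [Nat.one_le_iff_ne_zero] using hx)
    rw [← X_mul_monomial_one]
    refine h x e ?_
    simp only [map_add, Finsupp.degree_single] at hd
    omega

theorem VanishesBelow.apply_one {N : ℕ} {τ : Form σ} (h : VanishesBelow (N + 1) τ) :
    τ 1 = 0 := by
  simpa using h 0 (by simp)

theorem VanishesBelow.mulVar {N : ℕ} {τ : Form σ} (h : VanishesBelow (N + 1) τ) (x : σ) :
    VanishesBelow N (mulVar x τ) := by
  intro d hd
  rw [mulVar_apply, X_mul_monomial_one]
  refine h _ ?_
  simp only [map_add, Finsupp.degree_single]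
  omega

theorem VanishesBelow.mono {M N : ℕ} {τ : Form σ} (h : VanishesBelow N τ) (hMN : M ≤ N) :
    VanishesBelow M τ :=
  fun d hd => h d (hd.trans_le hMN)

theorem VanishesBelow.add {N : ℕ} {ρ τ : Form σ} (hρ : VanishesBelow N ρ)
    (hτ : VanishesBelow N τ) : VanishesBelow N (ρ + τ) :=
  fun d hd => by simp [hρ d hd, hτ d hd]

theorem VanishesBelow.conv_right {N : ℕ} {τ : Form σ} (h : VanishesBelow N τ) (ρ : Form σ) :
    VanishesBelow N (conv ρ τ) := by
  induction N generalizing ρ τ with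
  | zero => exact fun d hd => absurd hd (Nat.not_lt_zero _)
  | succ N ih =>
    refine vanishesBelow_succ (by simp [conv_one, h.apply_one]) fun x => ?_
    rw [mulVar_conv]
    exact (ih (h.mono N.le_succ) _).add (ih (h.mulVar x) _)

theorem conv_comm (ρ τ : Form σ) : conv ρ τ = conv τ ρ := by
  refine LinearMap.ext fun u => ?_
  induction u using MvPolynomial.induction_on generalizing ρ τ with
  | C a => simp [C_eq_smul_one, conv_one, mul_comm]
  | add p q hp hq => rw [map_add, map_add, hp, hq]
  | mul_X p x hp =>
    rw [mul_comm p, ← mulVar_apply, ← mulVar_apply, mulVar_conv, mulVar_conv,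
      LinearMap.add_apply, LinearMap.add_apply, hp, hp ρ, add_comm]

theorem conv_assoc (ρ τ υ : Form σ) : conv (conv ρ τ) υ = conv ρ (conv τ υ) := by
  refine LinearMap.ext fun u => ?_
  induction u using MvPolynomial.induction_on generalizing ρ τ υ with
  | C a => simp [C_eq_smul_one, conv_one, mul_assoc]
  | add p q hp hq => rw [map_add, map_add, hp, hq]
  | mul_X p x hp =>
    rw [mul_comm p, ← mulVar_apply, ← mulVar_apply]
    simp only [mulVar_conv, conv_add_left, conv_add_right, LinearMap.add_apply, hp, add_assoc]

theorem mulVar_counitF (x : σ) : mulVar x (counitF σ) = 0 := by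
  refine LinearMap.ext fun u => ?_
  simp [counitF]

theorem mulVar_convPow_zero (x : σ) (r : Form σ) : mulVar x (convPow r 0) = 0 :=
  mulVar_counitF x

theorem mulVar_convPow_succ (x : σ) (r : Form σ) (n : ℕ) :
    mulVar x (convPow r (n + 1)) = ((n : ℚ) + 1) • conv (mulVar x r) (convPow r n) := by
  induction n with
  | zero =>
    change mulVar x (conv (convPow r 0) r) = _
    rw [mulVar_conv, mulVar_convPow_zero, conv_zero_left,
      conv_comm _ (mulVar x r)]
    simp
  | succ n ih =>
    rw [convPow, mulVar_conv, ih, conv_smul_left, conv_assoc, ← convPow,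
      conv_comm _ (mulVar x r)]
    push_cast
    module

theorem vanishesBelow_convPow {r : Form σ} (hr : r 1 = 0) (n : ℕ) :
    VanishesBelow n (convPow r n) := by
  induction n with
  | zero => exact fun d hd => absurd hd (Nat.not_lt_zero _)
  | succ n ih =>
    refine vanishesBelow_succ (by simp [convPow, conv_one, hr]) fun x d hd => ?_
    rw [mulVar_convPow_succ, LinearMap.smul_apply, ih.conv_right _ d hd, smul_zero]

theorem convExp_monomial {r : Form σ} (hr : r 1 = 0) {N : ℕ} {d : σ →₀ ℕ}
    (hd : d.degree < N) :
    convExp r (monomial d 1) =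
      (∑ n ∈ Finset.range N, (n.factorial : ℚ)⁻¹ • convPow r n) (monomial d 1) := by
  have h := (basisMonomials σ ℚ).constr_basis ℚ (fun d : σ →₀ ℕ =>
    ∑ n ∈ Finset.range ((d.sum fun _ e => e) + 1),
      ((n.factorial : ℚ))⁻¹ * convPow r n (monomial d 1)) d
  rw [coe_basisMonomials] at h
  rw [convExp, h, LinearMap.sum_apply]
  refine Finset.sum_subset (Finset.range_mono hd) fun n _ hn => ?_
  rw [vanishesBelow_convPow hr n d (not_lt.mp fun h => hn (Finset.mem_range.mpr h)), mul_zero]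

end Convolution

/-- Lemma 5.2: for `r` an infinitesimal form, `a = X x` and any `u`,
`e^{∗r}(a·u) = Σ r(a·u₍₁₎) · e^{∗r}(u₍₂₎)` where `Δu = Σ u₍₁₎ ⊗ u₍₂₎`; the
right-hand Sweedler sum is the convolution `(r ∘ (a·-)) ∗ e^{∗r}` applied to `u`. -/
theorem stmt4 (σ : Type) (r : Form σ) (hr : r 1 = 0) (x : σ) (u : H σ) :
    convExp r (X x * u) =
      conv (r ∘ₗ LinearMap.mulLeft ℚ (X x)) (convExp r) u := by
  suffices h : mulVar x (convExp r) = conv (mulVar x r) (convExp r) from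
    LinearMap.congr_fun h u
  refine form_ext fun d => ?_
  set N := d.degree + 1
  have hexp : VanishesBelow N
      (convExp r - ∑ n ∈ Finset.range N, (n.factorial : ℚ)⁻¹ • convPow r n) := fun e he => by
    rw [LinearMap.sub_apply, convExp_monomial hr he, sub_self]
  have hconv := hexp.conv_right (mulVar x r) d (Nat.lt_succ_self _)
  rw [conv_sub_right, LinearMap.sub_apply, sub_eq_zero] at hconv
  have hdeg : (Finsupp.single x 1 + d).degree < N + 1 := by
    simp only [map_add, Finsupp.degree_single]
    omega
  rw [hconv, mulVar_apply, X_mul_monomial_one, convExp_monomial hr hdeg, ← X_mul_monomial_one,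
    ← mulVar_apply, map_sum, Finset.sum_range_succ', ← convBilin_apply, map_sum]
  simp only [map_smul, mulVar_convPow_succ, mulVar_convPow_zero, smul_zero, add_zero,
    convBilin_apply, smul_smul]
  congr 1
  refine Finset.sum_congr rfl fun n _ => ?_
  congr 1
  rw [Nat.factorial_succ]
  push_cast
  field_simp

end
end

section
/- Let r be an infinitesimal form on H, let u ∈ H satisfy ε(u) = 0, and let v ∈ H. Then e^{∗r}(u·v) = Σ_{k≥1} (1/k!) Σ r(u⁽¹⁾·v₍₁₎) ⋯ r(u⁽ᵏ⁾·v₍ₖ₎) · e^{∗r}(v₍ₖ₊₁₎), where Δ̄ᵏ⁻¹u = Σ u⁽¹⁾ ⊗ ⋯ ⊗ u⁽ᵏ⁾, Δᵏv = Σ v₍₁₎ ⊗ ⋯ ⊗ v₍ₖ₊₁₎, and the sum over k is finite since Δ̄ᵏ⁻¹u = 0 for k > totalDegree u. -/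
/-! Statement 5: `e^{∗r}(u·v)` expanded along the reduced coproduct of `u`. -/

open MvPolynomial TensorProduct

noncomputable section

/-- The exponents of slot `i` in a monomial of `Hpow σ k`, as a monomial of `H`. -/
def slot (σ : Type) (k : ℕ) (i : Fin k) (d : σ × Fin k →₀ ℕ) : σ →₀ ℕ :=
  Finsupp.comapDomain (fun x : σ => (x, i)) d (fun _ _ _ _ h => congrArg Prod.fst h)

/-- The functional `f₀ ⊗ ⋯ ⊗ f_{k-1}` on `H^{⊗k}`, in the model `Hpow σ k`:
on a basis monomial it is the product of the values of the `f i` on its slots. -/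
def tensorEval {σ : Type} {k : ℕ} (f : Fin k → Form σ) :
    MvPolynomial (σ × Fin k) ℚ →ₗ[ℚ] ℚ :=
  (basisMonomials (σ × Fin k) ℚ).constr ℚ fun d =>
    ∏ i : Fin k, f i (monomial (slot σ k i d) 1)

lemma slot_sum_mapDomain {σ : Type} {k : ℕ} (e : Fin k → σ →₀ ℕ) (j : Fin k) :
    slot σ k j (∑ i, Finsupp.mapDomain (fun x : σ => (x, i)) (e i)) = e j := by
  ext x
  change (∑ i, Finsupp.mapDomain (fun x : σ => (x, i)) (e i)) (x, j) = e j x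
  rw [Finsupp.finsetSum_apply, Finset.sum_eq_single j]
  · exact Finsupp.mapDomain_apply (fun _ _ h => congrArg Prod.fst h) _ _
  · intro i _ hij
    exact Finsupp.mapDomain_of_notMem_range _ _ fun ⟨y, hy⟩ => hij (congrArg Prod.snd hy)
  · simp

lemma sum_mapDomain_slot {σ : Type} {k : ℕ} (d : σ × Fin k →₀ ℕ) :
    ∑ i, Finsupp.mapDomain (fun x : σ => (x, i)) (slot σ k i d) = d := by
  ext ⟨x, j⟩
  exact DFunLike.congr_fun (slot_sum_mapDomain (fun i => slot σ k i d) j) x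

lemma prod_rename_monomial {σ : Type} {k : ℕ} (e : Fin k → σ →₀ ℕ) (c : Fin k → ℚ) :
    ∏ i, rename (fun x : σ => (x, i)) (monomial (e i) (c i)) =
      monomial (∑ i, Finsupp.mapDomain (fun x : σ => (x, i)) (e i)) (∏ i, c i) := by
  simp only [rename_monomial]
  exact (monomial_sum_prod _ _ _).symm

lemma monomial_eq_prod_slot {σ : Type} {k : ℕ} (d : σ × Fin k →₀ ℕ) :
    monomial d (1 : ℚ) = ∏ i, rename (fun x : σ => (x, i)) (monomial (slot σ k i d) 1) := by
  rw [prod_rename_monomial, sum_mapDomain_slot, Finset.prod_const_one]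

lemma tensorEval_monomial {σ : Type} {k : ℕ} (f : Fin k → Form σ) (d : σ × Fin k →₀ ℕ) (c : ℚ) :
    tensorEval f (monomial d c) = c * ∏ i, f i (monomial (slot σ k i d) 1) := by
  have h : monomial d c = c • basisMonomials (σ × Fin k) ℚ d := by simp [smul_monomial]
  rw [h, map_smul, tensorEval, Module.Basis.constr_basis, smul_eq_mul]

lemma tensorEval_prod {σ : Type} {k : ℕ} (f : Fin k → Form σ) (p : Fin k → H σ) :
    tensorEval f (∏ i, rename (fun x : σ => (x, i)) (p i)) = ∏ i, f i (p i) := by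
  classical
  have h (i : Fin k) : p i = ∑ d ∈ (p i).support, monomial d (coeff d (p i)) := (p i).as_sum
  have hf (i : Fin k) (d : σ →₀ ℕ) (c : ℚ) : f i (monomial d c) = c * f i (monomial d 1) := by
    rw [← smul_eq_mul, ← map_smul, smul_monomial, smul_eq_mul, mul_one]
  calc
    _ = tensorEval f (∏ i, ∑ d ∈ (p i).support,
          rename (fun x : σ => (x, i)) (monomial d (coeff d (p i)))) := by
      congr 1
      refine Finset.prod_congr rfl fun i _ => ?_
      conv_lhs => rw [h i, map_sum]
    _ = ∏ i, ∑ d ∈ (p i).support, f i (monomial d (coeff d (p i))) := by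
      rw [Finset.prod_univ_sum, Finset.prod_univ_sum, map_sum]
      refine Finset.sum_congr rfl fun e _ => ?_
      rw [prod_rename_monomial, tensorEval_monomial, ← Finset.prod_mul_distrib]
      refine Finset.prod_congr rfl fun i _ => ?_
      rw [slot_sum_mapDomain, hf i (e i) (coeff _ _)]
    _ = _ := by
      refine Finset.prod_congr rfl fun i _ => ?_
      conv_rhs => rw [h i, map_sum]

/-- The algebra map `⨂ φ i` between tensor powers, in the model `Hpow`. -/
def slotMap {τ σ : Type} {k : ℕ} (φ : Fin k → H τ →ₐ[ℚ] H σ) : Hpow τ k →ₐ[ℚ] Hpow σ k :=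
  aeval fun p => rename (fun x : σ => (x, p.2)) (φ p.2 (X p.1))

lemma slotMap_rename {τ σ : Type} {k : ℕ} (φ : Fin k → H τ →ₐ[ℚ] H σ) (i : Fin k) (p : H τ) :
    slotMap φ (rename (fun x : τ => (x, i)) p) = rename (fun x : σ => (x, i)) (φ i p) := by
  have : (slotMap φ).comp (rename fun x : τ => (x, i)) = (rename fun x : σ => (x, i)).comp (φ i) := by
    ext x : 1
    simp [slotMap]
  exact DFunLike.congr_fun this p

lemma tensorEval_slotMap {τ σ : Type} {k : ℕ} (f : Fin k → Form σ) (φ : Fin k → H τ →ₐ[ℚ] H σ)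
    (P : Hpow τ k) :
    tensorEval f (slotMap φ P) = tensorEval (fun i => f i ∘ₗ (φ i).toLinearMap) P := by
  suffices h : tensorEval f ∘ₗ (slotMap φ).toLinearMap =
      tensorEval (fun i => f i ∘ₗ (φ i).toLinearMap) from DFunLike.congr_fun h P
  refine (basisMonomials _ ℚ).ext fun d => ?_
  simp only [coe_basisMonomials, LinearMap.comp_apply, AlgHom.toLinearMap_apply]
  rw [monomial_eq_prod_slot, map_prod, tensorEval_prod]
  simp only [slotMap_rename, tensorEval_prod, LinearMap.comp_apply, AlgHom.toLinearMap_apply]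

lemma tensorEval_mul_last {σ : Type} {k : ℕ} (f : Fin (k + 1) → Form σ) (P : Hpow σ k) (b : H σ) :
    tensorEval f (rename (Prod.map id Fin.castSucc) P * rename (fun x : σ => (x, Fin.last k)) b) =
      tensorEval (fun i => f i.castSucc) P * f (Fin.last k) b := by
  suffices h : tensorEval f ∘ₗ (LinearMap.mulRight ℚ (rename (fun x : σ => (x, Fin.last k)) b)) ∘ₗ
      (rename (Prod.map id Fin.castSucc)).toLinearMap =
        LinearMap.mulRight ℚ (f (Fin.last k) b) ∘ₗ tensorEval (fun i => f i.castSucc) from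
    DFunLike.congr_fun h P
  refine (basisMonomials _ ℚ).ext fun d => ?_
  simp only [coe_basisMonomials, LinearMap.comp_apply, AlgHom.toLinearMap_apply,
    LinearMap.mulRight_apply]
  rw [monomial_eq_prod_slot, map_prod, tensorEval_prod]
  have h := tensorEval_prod f (Fin.snoc (fun i => monomial (slot σ k i d) 1) b)
  simp only [Fin.prod_univ_castSucc, Fin.snoc_castSucc, Fin.snoc_last] at h
  rw [← h]
  simp only [rename_rename]
  rfl

/-- The coalgebra structure on polynomials in which the variables are primitive.  It takes
precedence over the group-like structure of `AddMonoidAlgebra.instCoalgebra`. -/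
instance primitiveCoalgebra (τ : Type) : Coalgebra ℚ (MvPolynomial τ ℚ) :=
  (Bialgebra.ofAlgHom (Delta τ) (aeval fun _ => 0)
    (by
      ext x : 1
      simp [Delta, TensorProduct.tmul_add, TensorProduct.add_tmul,
        Algebra.TensorProduct.one_def, add_assoc])
    (by ext x : 1; simp [Delta])
    (by ext x : 1; simp [Delta])).toCoalgebra

instance primitiveCoalgebra_isCocomm (τ : Type) : Coalgebra.IsCocomm ℚ (MvPolynomial τ ℚ) where
  comm_comp_comul := by
    have : (Algebra.TensorProduct.comm ℚ (H τ) (H τ)).toAlgHom.comp (Delta τ) = Delta τ := by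
      ext x : 1
      simp [Delta, add_comm]
    exact LinearMap.ext fun x => DFunLike.congr_fun this x

open WithConv

lemma conv_eq {σ : Type} (ρ τ : Form σ) : conv ρ τ = (toConv ρ * toConv τ).ofConv := by
  have : (TensorProduct.lid ℚ ℚ).toLinearMap = LinearMap.mul' ℚ ℚ := by ext; simp
  rw [conv, this]
  rfl

lemma convPow_eq {σ : Type} (ρ : Form σ) (n : ℕ) : convPow ρ n = (toConv ρ ^ n).ofConv := by
  induction n with
  | zero => rfl
  | succ n ih => rw [convPow, conv_eq, ih, pow_succ]

lemma DIter_zero (σ : Type) : DIter σ 0 = (Algebra.ofId ℚ _).comp (aeval fun _ => 0) := by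
  ext x : 1
  simp [DIter]

lemma tensorEval_DIter {σ : Type} {n : ℕ} (f : Fin n → Form σ) (w : H σ) :
    tensorEval f (DIter σ n w) = (∏ i, toConv (f i)).ofConv w := by
  induction n generalizing w with
  | zero =>
    have hC (c : ℚ) : tensorEval f (C c) = c := by
      rw [C_apply, tensorEval_monomial, Fin.prod_univ_zero, mul_one]
    rw [DIter_zero]
    exact hC _
  | succ n ih =>
    let join : H σ ⊗[ℚ] H σ →ₐ[ℚ] Hpow σ (n + 1) :=
      Algebra.TensorProduct.productMap
        ((rename (Prod.map id Fin.castSucc)).comp (DIter σ n))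
        (rename fun x : σ => (x, Fin.last n))
    have h₁ : join.comp (Delta σ) = DIter σ (n + 1) := by
      ext x : 1
      simp [join, Delta, DIter, Fin.sum_univ_castSucc]
    have h₂ : tensorEval f ∘ₗ join.toLinearMap = LinearMap.mul' ℚ ℚ ∘ₗ
        TensorProduct.map (∏ i : Fin n, toConv (f i.castSucc)).ofConv (f (Fin.last n)) := by
      refine TensorProduct.ext' fun a b => ?_
      simp [join, tensorEval_mul_last, ih]
    rw [Fin.prod_univ_castSucc, ← h₁]
    exact DFunLike.congr_fun h₂ (Delta σ w)

lemma exists_slot_eq_zero {σ : Type} {k : ℕ} {d : σ × Fin k →₀ ℕ} (h : d.degree < k) :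
    ∃ i, slot σ k i d = 0 := by
  by_contra! hd
  have hdeg : d.degree = ∑ i, (slot σ k i d).degree := by
    conv_lhs => rw [← sum_mapDomain_slot d, map_sum]
    exact Finset.sum_congr rfl fun i _ => Finsupp.degree_mapDomain _ _
  have : ∑ _i : Fin k, 1 ≤ ∑ i, (slot σ k i d).degree := Finset.sum_le_sum fun i _ =>
    Nat.one_le_iff_ne_zero.2 fun h0 => hd i ((Finsupp.degree_eq_zero_iff _).1 h0)
  simp at this
  omega

lemma totalDegree_aeval_le {τ ρ : Type} (g : τ → MvPolynomial ρ ℚ)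
    (hg : ∀ x, (g x).totalDegree ≤ 1) (w : MvPolynomial τ ℚ) :
    (aeval g w).totalDegree ≤ w.totalDegree := by
  rw [aeval_def, eval₂_eq]
  refine totalDegree_finsetSum_le fun d hd => ?_
  refine (totalDegree_mul _ _).trans ?_
  rw [algebraMap_eq, totalDegree_C, zero_add]
  refine (totalDegree_finsetProd _ _).trans (le_trans ?_ (le_totalDegree hd))
  refine Finset.sum_le_sum fun x _ => (totalDegree_pow _ _).trans ?_
  simpa using Nat.mul_le_mul_left (d x) (hg x)

lemma totalDegree_DIter_le {σ : Type} (k : ℕ) (w : H σ) :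
    (DIter σ k w).totalDegree ≤ w.totalDegree :=
  totalDegree_aeval_le _ (fun _ => totalDegree_finsetSum_le fun _ _ => (totalDegree_X _).le) w

lemma tensorEval_congr {σ : Type} {k : ℕ} {f g : Fin k → Form σ} {P : Hpow σ k}
    (h : ∀ i d, d.degree ≤ P.totalDegree → f i (monomial d 1) = g i (monomial d 1)) :
    tensorEval f P = tensorEval g P := by
  rw [P.as_sum, map_sum, map_sum]
  refine Finset.sum_congr rfl fun d hd => ?_
  rw [tensorEval_monomial, tensorEval_monomial]
  congr 1
  refine Finset.prod_congr rfl fun i _ => h i _ (le_trans ?_ (le_totalDegree hd))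
  change _ ≤ d.degree
  conv_rhs => rw [← sum_mapDomain_slot d, map_sum]
  rw [← Finsupp.degree_mapDomain (fun x : σ => (x, i))]
  exact Finset.single_le_sum (f := fun i => (Finsupp.mapDomain (fun x : σ => (x, i))
    (slot σ k i d)).degree) (fun _ _ => Nat.zero_le _) (Finset.mem_univ i)

lemma tensorEval_eq_zero {σ : Type} {k : ℕ} {f : Fin k → Form σ} (hf : ∀ i, f i 1 = 0)
    {P : Hpow σ k} (hP : P.totalDegree < k) : tensorEval f P = 0 := by
  rw [P.as_sum, map_sum]
  refine Finset.sum_eq_zero fun d hd => ?_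
  obtain ⟨i, hi⟩ := exists_slot_eq_zero (lt_of_le_of_lt (le_totalDegree hd) hP)
  rw [tensorEval_monomial, Finset.prod_eq_zero (Finset.mem_univ i), mul_zero]
  rw [hi]
  exact hf i

lemma prod_toConv_eq_zero {σ : Type} {n : ℕ} {f : Fin n → Form σ} (hf : ∀ i, f i 1 = 0)
    {w : H σ} (hw : w.totalDegree < n) : (∏ i, toConv (f i)).ofConv w = 0 := by
  rw [← tensorEval_DIter]
  exact tensorEval_eq_zero hf ((totalDegree_DIter_le n w).trans_lt hw)

lemma convPow_eq_zero {σ : Type} {s : Form σ} (hs : s 1 = 0) {n : ℕ} {w : H σ}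
    (hw : w.totalDegree < n) : convPow s n w = 0 := by
  rw [convPow_eq]
  simpa using prod_toConv_eq_zero (f := fun _ : Fin n => s) (fun _ => hs) hw

/-- The exponential series of `s`, truncated after the term of order `N`. -/
def expTrunc {σ : Type} (s : Form σ) (N : ℕ) : Form σ :=
  ∑ n ∈ Finset.range (N + 1), ((n.factorial : ℚ))⁻¹ • convPow s n

lemma convExp_monomial_s5 {σ : Type} {s : Form σ} (hs : s 1 = 0) {N : ℕ} {d : σ →₀ ℕ}
    (hd : d.degree ≤ N) : convExp s (monomial d 1) = expTrunc s N (monomial d 1) := by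
  have h := (basisMonomials σ ℚ).constr_basis ℚ (fun d => ∑ n ∈ Finset.range
    ((d.sum fun _ e => e) + 1), ((n.factorial : ℚ))⁻¹ * convPow s n (monomial d 1)) d
  rw [coe_basisMonomials] at h
  rw [convExp, h, expTrunc]
  simp only [LinearMap.sum_apply, LinearMap.smul_apply, smul_eq_mul]
  refine Finset.sum_subset (Finset.range_mono (Nat.succ_le_succ hd)) fun n _ hn => ?_
  rw [convPow_eq_zero hs, mul_zero]
  rw [totalDegree_monomial _ one_ne_zero]
  simpa using hn

lemma convExp_eq {σ : Type} {s : Form σ} (hs : s 1 = 0) {N : ℕ} {w : H σ}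
    (hw : w.totalDegree ≤ N) : convExp s w = expTrunc s N w := by
  rw [w.as_sum, map_sum, map_sum]
  refine Finset.sum_congr rfl fun d hd => ?_
  have h : monomial d (coeff d w) = coeff d w • monomial d (1 : ℚ) := by simp [smul_monomial]
  rw [h, map_smul, map_smul, convExp_monomial_s5 hs ((le_totalDegree hd).trans hw)]

lemma totalDegree_DbarIter_le {σ : Type} (k : ℕ) (u : H σ) :
    (DbarIter σ k u).totalDegree ≤ u.totalDegree := by
  simp only [DbarIter, LinearMap.comp_apply, LinearMap.sum_apply, LinearMap.smul_apply,
    AlgHom.toLinearMap_apply]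
  refine totalDegree_finsetSum_le fun S _ => (totalDegree_smul_le _ _).trans
    ((totalDegree_aeval_le _ (fun p => ?_) _).trans (totalDegree_DIter_le k u))
  split_ifs <;> simp

lemma DbarIter_zero {σ : Type} {u : H σ} (hu : constantCoeff u = 0) : DbarIter σ 0 u = 0 := by
  rw [DbarIter, LinearMap.comp_apply, AlgHom.toLinearMap_apply, DIter_zero, AlgHom.comp_apply,
    aeval_zero', hu]
  simp

lemma DbarIter_eq_zero {σ : Type} {k : ℕ} {u : H σ} (hu : u.totalDegree < k) :
    DbarIter σ k u = 0 := by
  have h : DIter σ k u = ∑ d ∈ (DIter σ k u).support, monomial d (coeff d (DIter σ k u)) :=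
    (DIter σ k u).as_sum
  rw [DbarIter, LinearMap.comp_apply, AlgHom.toLinearMap_apply, h, map_sum]
  refine Finset.sum_eq_zero fun d hd => ?_
  obtain ⟨i, hi⟩ := exists_slot_eq_zero
    ((le_totalDegree hd).trans_lt ((totalDegree_DIter_le k u).trans_lt hu))
  have hd (x : σ) : d (x, i) = 0 := DFunLike.congr_fun hi x
  have hS (S : Finset (Fin k)) (c : ℚ) : zeroSlots σ k (symmDiff S {i}) (monomial d c) =
      zeroSlots σ k S (monomial d c) := by
    rw [zeroSlots, zeroSlots, aeval_monomial, aeval_monomial]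
    congr 1
    refine Finsupp.prod_congr fun p hp => ?_
    have hpi : p.2 ≠ i := by
      rintro rfl
      exact Finsupp.mem_support_iff.1 hp (hd p.1)
    simp [Finset.mem_symmDiff, hpi]
  simp only [LinearMap.sum_apply, LinearMap.smul_apply, AlgHom.toLinearMap_apply]
  refine Finset.sum_involution (fun S _ => symmDiff S {i}) (fun S _ => ?_) (fun S _ _ => ?_)
    (fun _ _ => Finset.mem_univ _) (fun S _ => symmDiff_symmDiff_cancel_right _ _)
  · rw [hS]
    have hcard : (-1 : ℚ) ^ (symmDiff S {i}).card = -(-1) ^ S.card := by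
      by_cases hi : i ∈ S
      · have : symmDiff S {i} = S.erase i := by
          ext j
          by_cases hj : j = i <;> simp [Finset.mem_symmDiff, hj, hi]
        rw [this, ← Finset.card_erase_add_one hi, pow_succ]
        ring
      · have : symmDiff S {i} = insert i S := by
          ext j
          by_cases hj : j = i <;> simp [Finset.mem_symmDiff, hj, hi]
        rw [this, Finset.card_insert_of_notMem hi, pow_succ]
        ring
    rw [hcard, neg_smul, add_neg_cancel]
  · simp

/-- The algebra map `u ⊗ v ↦ u(c · X) * v`, on `H ⊗ H` modelled by the variables `σ ⊕ σ`.  It is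
the multiplication for `c = 1` and `ε ⊗ id` for `c = 0`. -/
def scaleMul (σ : Type) (c : ℚ) : H (σ ⊕ σ) →ₐ[ℚ] H σ :=
  aeval (Sum.elim (fun x => C c * X x) X)

lemma slotMap_scaleMul_DIter {σ : Type} (k : ℕ) (c : ℚ) (w : H (σ ⊕ σ)) :
    slotMap (fun _ : Fin k => scaleMul σ c) (DIter (σ ⊕ σ) k w) = DIter σ k (scaleMul σ c w) := by
  have h : (slotMap fun _ => scaleMul σ c).comp (DIter (σ ⊕ σ) k) =
      (DIter σ k).comp (scaleMul σ c) := by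
    ext (x | x) : 1
    · simp [slotMap, DIter, scaleMul, Finset.mul_sum, algHom_C, algebraMap_eq]
    · simp [slotMap, DIter, scaleMul]
  exact DFunLike.congr_fun h w

lemma toConv_convPow_comp_scaleMul {σ : Type} (s : Form σ) (c : ℚ) (n : ℕ) :
    toConv (convPow s n ∘ₗ (scaleMul σ c).toLinearMap) =
      toConv (s ∘ₗ (scaleMul σ c).toLinearMap) ^ n := by
  apply WithConv.ofConv_injective
  refine LinearMap.ext fun w => ?_
  have h₁ := tensorEval_DIter (fun _ : Fin n => s) (scaleMul σ c w)
  have h₂ := tensorEval_DIter (fun _ : Fin n => s ∘ₗ (scaleMul σ c).toLinearMap) w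
  rw [Finset.prod_const, Finset.card_univ, Fintype.card_fin] at h₁ h₂
  rw [← h₂, ← tensorEval_slotMap, slotMap_scaleMul_DIter, h₁, convPow_eq]
  rfl

lemma rename_zeroSlots_mul_DIter {σ : Type} {k : ℕ} (S : Finset (Fin k)) (u v : H σ) :
    rename (Prod.map id Fin.castSucc) (zeroSlots σ k S (DIter σ k u)) * DIter σ (k + 1) v =
      slotMap (fun i => scaleMul σ (Fin.snoc (α := fun _ => ℚ) (fun i => if i ∈ S then 0 else 1) 0 i))
        (DIter (σ ⊕ σ) (k + 1) (rename Sum.inl u * rename Sum.inr v)) := by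
  set φ : Fin (k + 1) → H (σ ⊕ σ) →ₐ[ℚ] H σ :=
    fun i => scaleMul σ (Fin.snoc (α := fun _ => ℚ) (fun i => if i ∈ S then 0 else 1) 0 i) with hφ
  have h₁ : (rename (Prod.map id Fin.castSucc)).comp ((zeroSlots σ k S).comp (DIter σ k)) =
      (slotMap φ).comp ((DIter (σ ⊕ σ) (k + 1)).comp (rename Sum.inl)) := by
    ext x : 1
    simp [DIter, slotMap, zeroSlots, scaleMul, hφ, Fin.sum_univ_castSucc]
    refine Finset.sum_congr rfl fun i _ => ?_
    split_ifs <;> simp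
  have h₂ : DIter σ (k + 1) = (slotMap φ).comp ((DIter (σ ⊕ σ) (k + 1)).comp (rename Sum.inr)) := by
    ext x : 1
    simp [DIter, slotMap, scaleMul, hφ]
  rw [map_mul, map_mul]
  exact congrArg₂ (· * ·) (DFunLike.congr_fun h₁ u) (DFunLike.congr_fun h₂ v)

lemma sum_neg_one_pow_card_prod_ite {A : Type} [CommRing A] [Algebra ℚ A] (k : ℕ) (a b : A) :
    ∑ S : Finset (Fin k), (-1 : ℚ) ^ S.card • ∏ i, (if i ∈ S then b else a) = (a - b) ^ k := by
  have h : (a - b) ^ k = ∏ _i : Fin k, (-b + a) := by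
    rw [Finset.prod_const, Finset.card_univ, Fintype.card_fin, neg_add_eq_sub]
  rw [h, Finset.prod_add, Finset.powerset_univ]
  refine Finset.sum_congr rfl fun S _ => ?_
  rw [Finset.prod_ite, Finset.filter_mem_eq_inter, Finset.univ_inter, ← Finset.sdiff_eq_filter,
    Finset.prod_const, Finset.prod_const, Finset.prod_const, neg_pow b, Algebra.smul_def]
  simp [mul_assoc]

lemma tensorEval_DbarIter_mul_DIter {σ : Type} {k : ℕ} (r s : Form σ) (u v : H σ) :
    tensorEval (fun i : Fin (k + 1) => if (i : ℕ) < k then r else s)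
        (rename (Prod.map id Fin.castSucc) (DbarIter σ k u) * DIter σ (k + 1) v) =
      ((toConv (r ∘ₗ (scaleMul σ 1).toLinearMap) - toConv (r ∘ₗ (scaleMul σ 0).toLinearMap)) ^ k *
        toConv (s ∘ₗ (scaleMul σ 0).toLinearMap)).ofConv (rename Sum.inl u * rename Sum.inr v) := by
  rw [← sum_neg_one_pow_card_prod_ite, Finset.sum_mul, WithConv.ofConv_sum, LinearMap.sum_apply,
    DbarIter, LinearMap.comp_apply, LinearMap.sum_apply, map_sum, Finset.sum_mul, map_sum]
  refine Finset.sum_congr rfl fun S _ => ?_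
  rw [LinearMap.smul_apply, map_smul, smul_mul_assoc, map_smul, smul_mul_assoc, ofConv_smul,
    LinearMap.smul_apply]
  congr 1
  simp only [AlgHom.toLinearMap_apply]
  rw [rename_zeroSlots_mul_DIter, tensorEval_slotMap, tensorEval_DIter, Fin.prod_univ_castSucc]
  congr 3
  · refine Finset.prod_congr rfl fun i _ => ?_
    by_cases hi : i ∈ S <;> simp [hi]
  · simp

lemma pow_mul_pow_ofConv_eq_zero {τ : Type} {f g : Form τ} (hf : f 1 = 0) (hg : g 1 = 0) {k m : ℕ}
    {w : H τ} (hw : w.totalDegree < k + m) : (toConv f ^ k * toConv g ^ m).ofConv w = 0 := by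
  have h := prod_toConv_eq_zero (f := Fin.append (fun _ : Fin k => f) fun _ : Fin m => g)
    (fun i => by refine Fin.addCases (fun i => ?_) (fun i => ?_) i <;> simp [hf, hg]) hw
  simpa [Fin.prod_univ_add] using h

lemma sum_range_sum_antidiagonal {N : ℕ} {F : ℕ × ℕ → ℚ} (hF : ∀ p, N < p.1 + p.2 → F p = 0) :
    ∑ n ∈ Finset.range (N + 1), ∑ p ∈ Finset.HasAntidiagonal.antidiagonal n, F p =
      ∑ k ∈ Finset.range (N + 1), ∑ m ∈ Finset.range (N + 1), F (k, m) := by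
  rw [← Finset.sum_product']
  have h := Finset.sum_filter_of_ne (s := Finset.range (N + 1) ×ˢ Finset.range (N + 1)) (f := F)
    (p := fun p => p.1 + p.2 ≤ N) fun p _ hp => not_lt.1 fun h => hp (hF p h)
  rw [← h, ← Finset.sum_fiberwise_of_maps_to (t := Finset.range (N + 1))
    (g := fun p : ℕ × ℕ => p.1 + p.2)]
  · refine Finset.sum_congr rfl fun n hn => Finset.sum_congr ?_ fun _ _ => rfl
    ext ⟨a, b⟩
    simp only [Finset.HasAntidiagonal.mem_antidiagonal, Finset.mem_filter, Finset.mem_product,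
      Finset.mem_range] at *
    omega
  · intro p hp
    simp only [Finset.mem_filter, Finset.mem_range] at *
    omega

/-- Lemma 5.3: for `r` infinitesimal, `ε(u) = 0` and any `v`,
`e^{∗r}(u·v) = Σ_{k≥1} (1/k!) Σ r(u⁽¹⁾·v₍₁₎) ⋯ r(u⁽ᵏ⁾·v₍ₖ₎) · e^{∗r}(v₍ₖ₊₁₎)`,
where `Δ̄ᵏ⁻¹u = Σ u⁽¹⁾ ⊗ ⋯ ⊗ u⁽ᵏ⁾` and `Δᵏv = Σ v₍₁₎ ⊗ ⋯ ⊗ v₍ₖ₊₁₎`; the sum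
over `k` is finite since `Δ̄ᵏ⁻¹u = 0 ` for `k > totalDegree u`, so it is taken
over `1 ≤ k ≤ totalDegree u`.  The inner Sweedler sum is obtained by placing
`Δ̄ᵏ⁻¹u` in the first `k` slots of `H^{⊗(k+1)}`, multiplying by `Δᵏv`, and
evaluating `r` on the first `k` slots and `e^{∗r}` on the last one. -/
theorem stmt5 (σ : Type) (r : Form σ) (hr : r 1 = 0)
    (u : H σ) (hu : constantCoeff u = 0) (v : H σ) :
    convExp r (u * v) =
      ∑ k ∈ Finset.Icc 1 u.totalDegree,
        ((k.factorial : ℚ))⁻¹ *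
          tensorEval (fun i : Fin (k + 1) => if (i : ℕ) < k then r else convExp r)
            (rename (Prod.map id Fin.castSucc) (DbarIter σ k u) * DIter σ (k + 1) v) := by
  set N := u.totalDegree + v.totalDegree with hN
  set w : H (σ ⊕ σ) := rename Sum.inl u * rename Sum.inr v with hw
  set R := r ∘ₗ (scaleMul σ 1).toLinearMap with hR
  set R₀ := r ∘ₗ (scaleMul σ 0).toLinearMap with hR₀
  have hwN : w.totalDegree ≤ N := (totalDegree_mul _ _).trans
    (add_le_add (totalDegree_rename_le _ _) (totalDegree_rename_le _ _))
  have hR1 : R 1 = 0 := by simp [hR, hr]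
  have hR₀1 : R₀ 1 = 0 := by simp [hR₀, hr]
  have huv : u * v = scaleMul σ 1 w := by
    have h₁ : (scaleMul σ 1).comp (rename Sum.inl) = AlgHom.id ℚ (H σ) := by
      ext x : 1
      simp [scaleMul]
    have h₂ : (scaleMul σ 1).comp (rename Sum.inr) = AlgHom.id ℚ (H σ) := by
      ext x : 1
      simp [scaleMul]
    rw [hw, map_mul]
    exact congrArg₂ (· * ·) (DFunLike.congr_fun h₁ u).symm (DFunLike.congr_fun h₂ v).symm
  let F : ℕ × ℕ → ℚ := fun p => ((p.1.factorial : ℚ))⁻¹ * ((p.2.factorial : ℚ))⁻¹ *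
    (toConv (R - R₀) ^ p.1 * toConv R₀ ^ p.2).ofConv w
  have hF (p : ℕ × ℕ) (hp : N < p.1 + p.2) : F p = 0 := by
    simp only [F]
    rw [pow_mul_pow_ofConv_eq_zero (by simp [hR1, hR₀1]) hR₀1 (hwN.trans_lt hp), mul_zero]
  have hleft : convExp r (u * v) =
      ∑ n ∈ Finset.range (N + 1), ∑ p ∈ Finset.HasAntidiagonal.antidiagonal n, F p := by
    rw [convExp_eq hr (totalDegree_mul u v), expTrunc, LinearMap.sum_apply]
    refine Finset.sum_congr rfl fun n _ => ?_
    have h : convPow r n (u * v) = (toConv R ^ n).ofConv w := by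
      rw [huv, hR, ← toConv_convPow_comp_scaleMul]
      rfl
    have hsum : toConv R = toConv (R - R₀) + toConv R₀ := by
      rw [← toConv_add, sub_add_cancel]
    rw [LinearMap.smul_apply, h, hsum, (Commute.all _ _).add_pow', ofConv_sum,
      LinearMap.sum_apply, Finset.smul_sum]
    refine Finset.sum_congr rfl fun p hp => ?_
    obtain rfl := Finset.HasAntidiagonal.mem_antidiagonal.1 hp
    rw [ofConv_smul, LinearMap.smul_apply, nsmul_eq_mul, smul_eq_mul, ← mul_assoc,
      Nat.cast_add_choose ℚ]
    simp only [F]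
    congr 1
    field_simp
  have hright (k : ℕ) : ((k.factorial : ℚ))⁻¹ *
      tensorEval (fun i : Fin (k + 1) => if (i : ℕ) < k then r else convExp r)
        (rename (Prod.map id Fin.castSucc) (DbarIter σ k u) * DIter σ (k + 1) v) =
      ∑ m ∈ Finset.range (N + 1), F (k, m) := by
    have hdeg : (rename (Prod.map id Fin.castSucc) (DbarIter σ k u) *
        DIter σ (k + 1) v).totalDegree ≤ N := (totalDegree_mul _ _).trans (add_le_add
      ((totalDegree_rename_le _ _).trans (totalDegree_DbarIter_le k u)) (totalDegree_DIter_le _ v))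
    have htrunc : toConv (expTrunc r N ∘ₗ (scaleMul σ 0).toLinearMap) =
        ∑ m ∈ Finset.range (N + 1), ((m.factorial : ℚ))⁻¹ • toConv R₀ ^ m := by
      simp only [hR₀, ← toConv_convPow_comp_scaleMul, ← toConv_smul, ← toConv_sum]
      congr 1
      refine LinearMap.ext fun x => ?_
      simp [expTrunc]
    rw [tensorEval_congr (g := fun i : Fin (k + 1) => if (i : ℕ) < k then r else expTrunc r N),
      tensorEval_DbarIter_mul_DIter, htrunc, ← hR, ← hR₀, ← toConv_sub, Finset.mul_sum, ofConv_sum,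
      LinearMap.sum_apply, Finset.mul_sum]
    · refine Finset.sum_congr rfl fun m _ => ?_
      rw [mul_smul_comm, ofConv_smul, LinearMap.smul_apply, smul_eq_mul, ← mul_assoc]
    · intro i d hd
      split_ifs
      · rfl
      · exact convExp_monomial_s5 hr (hd.trans hdeg)
  rw [hleft, sum_range_sum_antidiagonal hF]
  simp only [← hright]
  refine (Finset.sum_subset (fun k hk => ?_) fun k _ hk => ?_).symm
  · simp only [Finset.mem_Icc, Finset.mem_range] at *
    omega
  · have : DbarIter σ k u = 0 := by
      obtain rfl | hk0 := Nat.eq_zero_or_pos k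
      · exact DbarIter_zero hu
      · exact DbarIter_eq_zero (by simp only [Finset.mem_Icc] at hk; omega)
    rw [this, map_zero, zero_mul, map_zero, mul_zero]

end
end

section
/- Let r be an infinitesimal form on H, let x : σ, write a := X x, and let n ≥ 1. Then e^{∗r}(aⁿ) = Σ_α n! · r(a¹)^{α₁} ⋯ r(aⁿ)^{αₙ} / (α₁!·(1!)^{α₁} · α₂!·(2!)^{α₂} ⋯ αₙ!·(n!)^{αₙ}), where the sum is over all n-tuples of nonnegative integers α = (α₁,…,αₙ) with α₁ + 2α₂ + ⋯ + nαₙ = n (the Faà di Bruno expansion of moments in terms of cumulants). -/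
/-! Statement 6: the Faà di Bruno expansion of `e^{∗r}(aⁿ)`. -/

open MvPolynomial TensorProduct

noncomputable section

/-- The exponential generating series `Σ ρ(aⁿ) tⁿ / n!` of the values of a form on the powers of
the variable `a = X x`. -/
def momentSeries {σ : Type} (x : σ) (ρ : Form σ) : PowerSeries ℚ :=
  PowerSeries.mk fun n => ρ (X x ^ n) / n.factorial

theorem conv_X_pow {σ : Type} (ρ τ : Form σ) (x : σ) (n : ℕ) :
    conv ρ τ (X x ^ n) =
      ∑ p ∈ Finset.HasAntidiagonal.antidiagonal n, (n.choose p.1 : ℚ) * (ρ (X x ^ p.1) * τ (X x ^ p.2)) := by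
  have hΔ : Delta σ (X x ^ n) =
      ∑ p ∈ Finset.HasAntidiagonal.antidiagonal n, n.choose p.1 • ((X x ^ p.1) ⊗ₜ[ℚ] (X x ^ p.2)) := by
    rw [map_pow, Delta, aeval_X, (Commute.all _ _).add_pow']
    simp only [Algebra.TensorProduct.tmul_pow, Algebra.TensorProduct.tmul_mul_tmul, one_pow,
      one_mul, mul_one]
  simp only [conv, LinearMap.comp_apply, AlgHom.toLinearMap_apply, hΔ, map_sum, map_nsmul,
    TensorProduct.map_tmul, LinearEquiv.coe_coe, TensorProduct.lid_tmul, smul_eq_mul]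
  simp only [nsmul_eq_mul]

theorem momentSeries_conv {σ : Type} (x : σ) (ρ τ : Form σ) :
    momentSeries x (conv ρ τ) = momentSeries x ρ * momentSeries x τ := by
  ext n
  simp only [momentSeries, PowerSeries.coeff_mk, PowerSeries.coeff_mul, conv_X_pow, Finset.sum_div]
  refine Finset.sum_congr rfl fun p hp => ?_
  obtain rfl := Finset.HasAntidiagonal.mem_antidiagonal.1 hp
  rw [Nat.cast_add_choose]
  field_simp

theorem momentSeries_convPow {σ : Type} (x : σ) (ρ : Form σ) (k : ℕ) :
    momentSeries x (convPow ρ k) = momentSeries x ρ ^ k := by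
  induction k with
  | zero =>
    ext n
    rcases eq_or_ne n 0 with rfl | hn
    · simp [momentSeries, convPow, counitF]
    · simp [momentSeries, convPow, counitF, PowerSeries.coeff_one, hn]
  | succ k ih => rw [convPow, momentSeries_conv, ih, pow_succ]

theorem convPow_X_pow {σ : Type} (x : σ) (ρ : Form σ) (k n : ℕ) :
    convPow ρ k (X x ^ n) = n.factorial * PowerSeries.coeff n (momentSeries x ρ ^ k) := by
  rw [← momentSeries_convPow, momentSeries, PowerSeries.coeff_mk]
  field_simp

theorem convExp_X_pow {σ : Type} (x : σ) (ρ : Form σ) (n : ℕ) :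
    convExp ρ (X x ^ n) = ∑ k ∈ Finset.range (n + 1),
      (k.factorial : ℚ)⁻¹ * (n.factorial * PowerSeries.coeff n (momentSeries x ρ ^ k)) := by
  have hX : (X x ^ n : MvPolynomial σ ℚ) = basisMonomials σ ℚ (Finsupp.single x n) := by
    rw [coe_basisMonomials, X_pow_eq_monomial]
  rw [convExp, hX, Module.Basis.constr_basis]
  simp [← X_pow_eq_monomial, convPow_X_pow]

/-- The coefficients of a power of a power series without constant term, by the multinomial
theorem. -/
theorem coeff_pow_eq_sum_piAntidiag {R : Type*} [CommRing R] (f : PowerSeries R)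
    (hf : PowerSeries.coeff 0 f = 0) (n k : ℕ) :
    PowerSeries.coeff n (f ^ k) =
      ∑ α ∈ (Finset.piAntidiag (Finset.univ : Finset (Fin n)) k).filter
          (fun α => ∑ i : Fin n, ((i : ℕ) + 1) * α i = n),
        (Nat.multinomial Finset.univ α : R) *
          ∏ i : Fin n, PowerSeries.coeff ((i : ℕ) + 1) f ^ α i := by
  set g : PowerSeries R := ∑ i : Fin n,
    PowerSeries.monomial ((i : ℕ) + 1) (PowerSeries.coeff ((i : ℕ) + 1) f) with hg
  have hdvd : (PowerSeries.X : PowerSeries R) ^ (n + 1) ∣ f - g := by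
    rw [PowerSeries.X_pow_dvd_iff]
    intro m hm
    rw [map_sub, hg, map_sum, sub_eq_zero]
    simp only [PowerSeries.coeff_monomial]
    rcases m with _ | m
    · simpa using hf
    · rw [Finset.sum_eq_single (⟨m, by omega⟩ : Fin n)]
      · simp
      · intro b _ hb
        rw [if_neg]
        contrapose! hb
        ext
        simp only
        omega
      · simp
  have hpow : PowerSeries.coeff n (f ^ k) = PowerSeries.coeff n (g ^ k) := by
    rw [← sub_eq_zero, ← map_sub]
    exact PowerSeries.X_pow_dvd_iff.1 (hdvd.trans (sub_dvd_pow_sub_pow f g k)) n n.lt_succ_self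
  rw [hpow, hg, Finset.sum_pow_eq_sum_piAntidiag, map_sum, Finset.sum_filter]
  refine Finset.sum_congr rfl fun α _ => ?_
  simp [PowerSeries.monomial_pow, PowerSeries.prod_monomial, ← nsmul_eq_mul,
    PowerSeries.coeff_monomial, mul_comm, eq_comm (a := n)]

/-- Equation (4) (Faà di Bruno): for `r` infinitesimal, `a = X x` and `n ≥ 1`,
`e^{∗r}(aⁿ) = Σ_α n!·r(a¹)^{α₁} ⋯ r(aⁿ)^{αₙ} /
              (α₁!(1!)^{α₁} α₂!(2!)^{α₂} ⋯ αₙ!(n!)^{αₙ})`,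
the sum being over all `(α₁,…,αₙ)` of nonnegative integers with
`α₁ + 2α₂ + ⋯ + nαₙ = n` (such tuples automatically satisfy `αᵢ ≤ n`,
so they form the finite set below; `α i` stands for `α_{i+1}`). -/
theorem stmt6 (σ : Type) (r : Form σ) (hr : r 1 = 0) (x : σ) (n : ℕ) (hn : 1 ≤ n) :
    convExp r ((X x) ^ n) =
      ∑ α ∈ (Fintype.piFinset fun _ : Fin n => Finset.range (n + 1)).filter
          (fun α => ∑ i : Fin n, ((i : ℕ) + 1) * α i = n),
        (n.factorial : ℚ) * (∏ i : Fin n, (r ((X x) ^ ((i : ℕ) + 1))) ^ (α i)) /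
          ∏ i : Fin n, (((α i).factorial : ℚ) * (((i : ℕ) + 1).factorial : ℚ) ^ (α i)) := by
  have h0 : PowerSeries.coeff 0 (momentSeries x r) = 0 := by simp [momentSeries, hr]
  have hle {α : Fin n → ℕ} (hα : ∑ i : Fin n, ((i : ℕ) + 1) * α i = n) : ∑ i, α i ≤ n :=
    (Finset.sum_le_sum fun i _ => Nat.le_mul_of_pos_left _ i.1.succ_pos).trans_eq hα
  rw [convExp_X_pow, ← Finset.sum_fiberwise_of_maps_to (t := Finset.range (n + 1))
    (g := fun α : Fin n → ℕ => ∑ i, α i)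
    fun α hα => Finset.mem_range_succ_iff.2 (hle (Finset.mem_filter.1 hα).2)]
  refine Finset.sum_congr rfl fun k _ => ?_
  rw [coeff_pow_eq_sum_piAntidiag _ h0, Finset.mul_sum, Finset.mul_sum]
  refine Finset.sum_congr ?_ fun α hα => ?_
  · ext α
    simp only [Finset.mem_filter, Finset.mem_piAntidiag, Fintype.mem_piFinset,
      Finset.mem_range_succ_iff, Finset.mem_univ, implies_true, and_true]
    exact ⟨fun h => ⟨⟨fun i => (Finset.single_le_sum (fun _ _ => Nat.zero_le _)
      (Finset.mem_univ i)).trans (hle h.2), h.2⟩, h.1⟩, fun h => ⟨h.2, h.1.2⟩⟩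
  · obtain rfl := (Finset.mem_filter.1 hα).2
    have hm : (Nat.multinomial Finset.univ α : ℚ) * ∏ i, ((α i).factorial : ℚ) =
        (∑ i, α i).factorial := by
      rw [mul_comm]
      exact_mod_cast Nat.multinomial_spec Finset.univ α
    have hα0 : ∏ i, ((α i).factorial : ℚ) ≠ 0 :=
      Finset.prod_ne_zero_iff.2 fun i _ => by positivity
    have hm' : (Nat.multinomial Finset.univ α : ℚ) ≠ 0 :=
      left_ne_zero_of_mul (hm.trans_ne (by positivity))
    rw [← hm]
    simp only [momentSeries, PowerSeries.coeff_mk, div_pow, Finset.prod_div_distrib,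
      Finset.prod_mul_distrib]
    field_simp

end
end

section
/- Let r be an infinitesimal form on H, let x₁,…,x_k : σ be pairwise distinct, let n₁,…,n_k be positive integers, and set u := ∏_{i=1}^{k} (X x_i)^{n_i} and N := n₁+⋯+n_k. Then e^{∗r}(u) = Σ_{l=1}^{N} (1/l!) Σ ∏_{i=1}^{k} (n_i! / (n_i¹! ⋯ n_i^l!)) · ∏_{j=1}^{l} r(∏_{i=1}^{k} (X x_i)^{n_iʲ}), where the inner sum runs over all k×l matrices (n_iʲ) of nonnegative integers whose i-th row sums to n_i for each i (any term containing a column of zeros vanishes because r(1) = 0). -/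
/-! Statement 10: expansion of `ρ = e^{∗r}` on a product of powers of distinct variables. -/

open MvPolynomial TensorProduct

noncomputable section

lemma prod_inv_factorial_mul_add_pow {ι A : Type*} [Fintype ι] [DecidableEq ι] [CommRing A]
    [Algebra ℚ A] (a b : ι → A) (d : ι →₀ ℕ) :
    ∏ i, ((d i).factorial : ℚ)⁻¹ • (a i + b i) ^ d i =
      ∑ p ∈ Finset.HasAntidiagonal.antidiagonal d,
        (∏ i, ((p.1 i).factorial : ℚ)⁻¹ • a i ^ p.1 i) *
          ∏ i, ((p.2 i).factorial : ℚ)⁻¹ • b i ^ p.2 i := by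
  have expand (i : ι) : ((d i).factorial : ℚ)⁻¹ • (a i + b i) ^ d i =
      ∑ p ∈ Finset.HasAntidiagonal.antidiagonal (d i),
        (((p.1).factorial : ℚ)⁻¹ • a i ^ p.1) * (((p.2).factorial : ℚ)⁻¹ • b i ^ p.2) := by
    rw [(Commute.all (a i) (b i)).add_pow', Finset.smul_sum]
    refine Finset.sum_congr rfl fun p hp => ?_
    rw [Finset.HasAntidiagonal.mem_antidiagonal] at hp
    rw [smul_mul_smul_comm, ← Nat.cast_smul_eq_nsmul ℚ, smul_smul, ← hp, Nat.cast_add_choose]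
    congr 1
    field_simp
  simp_rw [expand, Finset.prod_univ_sum, ← Finset.prod_mul_distrib]
  refine Finset.sum_bij'
    (fun f _ => (Finsupp.equivFunOnFinite.symm fun i => (f i).1,
      Finsupp.equivFunOnFinite.symm fun i => (f i).2))
    (fun p _ i => (p.1 i, p.2 i)) ?_ ?_ ?_ ?_ ?_
  · intro f hf
    simp only [Fintype.mem_piFinset, Finset.HasAntidiagonal.mem_antidiagonal] at hf ⊢
    ext i
    exact hf i
  · intro p hp
    simp only [Fintype.mem_piFinset, Finset.HasAntidiagonal.mem_antidiagonal] at hp ⊢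
    simp [← hp]
  · intro f _
    rfl
  · intro p _
    ext <;> rfl
  · intro f _
    rfl

/-- The divided-power generating series `Σ_d ρ(∏ᵢ (X xᵢ)^{dᵢ}) / ∏ᵢ dᵢ! · T^d` of a form `ρ`
along the points `xᵢ`. -/
def genSeries {σ ι : Type} [Fintype ι] (x : ι → σ) (ρ : Form σ) : MvPowerSeries ι ℚ :=
  fun d => ρ (∏ i, ((d i).factorial : ℚ)⁻¹ • X (x i) ^ d i)

section genSeries

variable {σ ι : Type} [Fintype ι] (x : ι → σ)

lemma coeff_genSeries (ρ : Form σ) (d : ι →₀ ℕ) :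
    MvPowerSeries.coeff d (genSeries x ρ) =
      ρ (∏ i, ((d i).factorial : ℚ)⁻¹ • X (x i) ^ d i) :=
  rfl

lemma coeff_genSeries_eq_mul (ρ : Form σ) (d : ι →₀ ℕ) :
    MvPowerSeries.coeff d (genSeries x ρ) =
      (∏ i, ((d i).factorial : ℚ)⁻¹) * ρ (∏ i, X (x i) ^ d i) := by
  rw [coeff_genSeries, Finset.prod_smul, map_smul, smul_eq_mul]

lemma genSeries_counitF : genSeries x (counitF σ) = 1 := by
  classical
  ext d
  rw [coeff_genSeries_eq_mul, MvPowerSeries.coeff_one]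
  split_ifs with hd
  · simp [hd, counitF]
  · obtain ⟨i, hi⟩ := Finsupp.ne_iff.mp hd
    have : ∏ i, (0 : ℚ) ^ d i = 0 :=
      Finset.prod_eq_zero (Finset.mem_univ i) (zero_pow hi)
    simp [counitF, this]

lemma genSeries_conv (ρ τ : Form σ) :
    genSeries x (conv ρ τ) = genSeries x ρ * genSeries x τ := by
  classical
  ext d
  rw [MvPowerSeries.coeff_mul]
  simp_rw [coeff_genSeries]
  have hDelta : Delta σ (∏ i, ((d i).factorial : ℚ)⁻¹ • X (x i) ^ d i) =
      ∑ p ∈ Finset.HasAntidiagonal.antidiagonal d,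
        (∏ i, ((p.1 i).factorial : ℚ)⁻¹ • X (x i) ^ p.1 i) ⊗ₜ[ℚ]
          ∏ i, ((p.2 i).factorial : ℚ)⁻¹ • X (x i) ^ p.2 i := by
    simp only [map_prod, map_smul, map_pow]
    simp only [Delta, aeval_X]
    rw [prod_inv_factorial_mul_add_pow]
    refine Finset.sum_congr rfl fun p _ => ?_
    have left (u : H σ) : u ⊗ₜ[ℚ] (1 : H σ) =
        (Algebra.TensorProduct.includeLeft : H σ →ₐ[ℚ] H σ ⊗[ℚ] H σ) u := rfl
    have right (u : H σ) : (1 : H σ) ⊗ₜ[ℚ] u =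
        (Algebra.TensorProduct.includeRight : H σ →ₐ[ℚ] H σ ⊗[ℚ] H σ) u := rfl
    simp only [left, right, ← map_pow, ← map_smul, ← map_prod]
    rw [← left, ← right, Algebra.TensorProduct.tmul_mul_tmul, mul_one, one_mul]
  simp [conv, hDelta]

lemma genSeries_convPow (ρ : Form σ) (l : ℕ) :
    genSeries x (convPow ρ l) = genSeries x ρ ^ l := by
  induction l with
  | zero => rw [pow_zero, convPow, genSeries_counitF]
  | succ l ih => rw [pow_succ, convPow, genSeries_conv, ih]

lemma convPow_prod_X_pow (ρ : Form σ) (l : ℕ) (d : ι →₀ ℕ) :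
    convPow ρ l (∏ i, X (x i) ^ d i) =
      (∏ i, ((d i).factorial : ℚ)) * MvPowerSeries.coeff d (genSeries x ρ ^ l) := by
  have : ∏ i, ((d i).factorial : ℚ) ≠ 0 :=
    Finset.prod_ne_zero_iff.mpr fun i _ => by positivity
  rw [← genSeries_convPow, coeff_genSeries_eq_mul, Finset.prod_inv_distrib,
    mul_inv_cancel_left₀ this]

end genSeries

lemma convExp_prod_X_pow {σ ι : Type} [Fintype ι] (s : Form σ) (x : ι → σ) (n : ι → ℕ) :
    convExp s (∏ i, X (x i) ^ n i) =
      ∑ l ∈ Finset.Ico 0 ((∑ i, n i) + 1),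
        (l.factorial : ℚ)⁻¹ * convPow s l (∏ i, X (x i) ^ n i) := by
  have hmon : (∏ i, X (x i) ^ n i : H σ) =
      monomial (∑ i, Finsupp.single (x i) (n i)) 1 := by
    simp [monomial_sum_one, X_pow_eq_monomial]
  have hdeg : ((∑ i, Finsupp.single (x i) (n i)).sum fun _ e => e) = ∑ i, n i := by
    change Finsupp.degree _ = _
    simp [map_sum]
  have hbasis : basisMonomials σ ℚ (∑ i, Finsupp.single (x i) (n i)) = monomial _ 1 :=
    congrFun (coe_basisMonomials σ ℚ) _
  rw [hmon, ← hdeg, convExp, ← hbasis, Module.Basis.constr_basis, hbasis,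
    Finset.range_eq_Ico]

lemma MvPowerSeries.coeff_pow_eq_sum_matrices {ι R : Type*} [Fintype ι] [DecidableEq ι]
    [CommSemiring R] (f : MvPowerSeries ι R) (l N : ℕ) (d : ι →₀ ℕ) (hd : ∀ i, d i ≤ N) :
    MvPowerSeries.coeff d (f ^ l) =
      ∑ M ∈ (Fintype.piFinset fun _ : ι =>
          Fintype.piFinset fun _ : Fin l => Finset.range (N + 1)).filter
            (fun M => ∀ i, ∑ j, M i j = d i),
        ∏ j, MvPowerSeries.coeff (Finsupp.equivFunOnFinite.symm fun i => M i j) f := by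
  classical
  have : f ^ l = ∏ _j : Fin l, f := by simp
  rw [this, MvPowerSeries.coeff_prod]
  refine Finset.sum_bij' (fun g _ i j => g j i)
    (fun M _ => Finsupp.equivFunOnFinite.symm fun j =>
      Finsupp.equivFunOnFinite.symm fun i => M i j) ?_ ?_ ?_ ?_ ?_
  · intro g hg
    simp only [Finset.mem_finsuppAntidiag, Finset.mem_filter, Fintype.mem_piFinset,
      Finset.mem_range, Nat.lt_succ_iff] at hg ⊢
    have hsum (i : ι) : ∑ j, g j i = d i := by rw [← hg.1, Finsupp.finsetSum_apply]
    exact ⟨fun i j => (Finset.single_le_sum (f := fun j => g j i) (fun _ _ => Nat.zero_le _)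
      (Finset.mem_univ j)).trans ((hsum i).trans_le (hd i)), hsum⟩
  · intro M hM
    simp only [Finset.mem_finsuppAntidiag, Finset.mem_filter] at hM ⊢
    refine ⟨?_, Finset.subset_univ _⟩
    ext i
    simpa [Finsupp.finsetSum_apply] using hM.2 i
  · intro g _
    ext
    rfl
  · intro M _
    rfl
  · intro g _
    refine Finset.prod_congr rfl fun j _ => ?_
    congr 2
    ext
    rfl

/-- Proposition 5.4: for `r` infinitesimal, pairwise distinct points
`x₁,…,x_K` (`K ≥ 1`), positive exponents `n₁,…,n_K`,
`u = ∏ᵢ (X xᵢ)^{nᵢ}` and `N = n₁+⋯+n_K`: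
`e^{∗r}(u) = Σ_{l=1}^{N} (1/l!) Σ_{(n_iʲ)} ∏ᵢ (nᵢ!/(nᵢ¹!⋯nᵢˡ!)) ·
             ∏ⱼ r(∏ᵢ (X xᵢ)^{n_iʲ})`,
the inner sum being over all `K × l` matrices `M` of nonnegative integers
whose `i`-th row sums to `nᵢ` (all entries of such matrices are `≤ N`, so they
form the finite set below; terms containing a column of zeros vanish since
`r(1) = 0`, which is why the sum over `l` stops at `N`). -/
theorem stmt10 (σ : Type) (r : Form σ) (hr : r 1 = 0)
    (K : ℕ) (hK : 0 < K) (x : Fin K → σ) (hx : Function.Injective x)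
    (n : Fin K → ℕ) (hn : ∀ i, 0 < n i) :
    convExp r (∏ i : Fin K, (X (x i)) ^ (n i)) =
      ∑ l ∈ Finset.Icc 1 (∑ i : Fin K, n i),
        ((l.factorial : ℚ))⁻¹ *
          ∑ M ∈ (Fintype.piFinset fun _ : Fin K =>
                Fintype.piFinset fun _ : Fin l =>
                  Finset.range ((∑ i : Fin K, n i) + 1)).filter
              (fun M => ∀ i : Fin K, ∑ j : Fin l, M i j = n i),
            (∏ i : Fin K, ((n i).factorial : ℚ) / ∏ j : Fin l, ((M i j).factorial : ℚ)) *
              ∏ j : Fin l, r (∏ i : Fin K, (X (x i)) ^ (M i j)) := by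
  obtain ⟨d, rfl⟩ : ∃ d : Fin K →₀ ℕ, n = d := ⟨Finsupp.equivFunOnFinite.symm n, rfl⟩
  have hd0 : d ≠ 0 := fun h => (hn ⟨0, hK⟩).ne' (by rw [h]; rfl)
  rw [convExp_prod_X_pow, Finset.sum_eq_sum_Ico_succ_bot (Nat.succ_pos _),
    convPow_prod_X_pow, pow_zero, MvPowerSeries.coeff_one, if_neg hd0, mul_zero, mul_zero, zero_add]
  refine Finset.sum_congr (by ext; simp) fun l _ => ?_
  rw [convPow_prod_X_pow, MvPowerSeries.coeff_pow_eq_sum_matrices _ l (∑ i, d i) _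
    fun i => Finset.single_le_sum (f := d) (fun _ _ => Nat.zero_le _) (Finset.mem_univ i),
    Finset.mul_sum]
  congr 1
  refine Finset.sum_congr (by ext; simp) fun M _ => ?_
  simp only [coeff_genSeries_eq_mul, Finsupp.coe_equivFunOnFinite_symm]
  rw [Finset.prod_mul_distrib, Finset.prod_comm, Finset.prod_div_distrib, div_eq_mul_inv, mul_assoc]
  simp only [Finset.prod_inv_distrib]

end
end

section
/- For all natural numbers n, k, l one has the convolution identity binomial(k+l, k) · 𝐒ₙ^{k+l} = Σ_{m=0}^{n} 𝐒ₘ^{k} · 𝐒_{n−m}^{l} in Q = MvPolynomial ℕ ℚ. -/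
/-! Statement 13: the convolution identity for the 𝐒ₙᵏ. -/

open MvPolynomial TensorProduct

noncomputable section

/-- Model of the extended algebra `qSym` of symmetric functions: the free
commutative ℚ-algebra on the variables `Qₘ = X m`, `m : ℕ` (`Q₀ = q` an extra
variable and `Qₘ = Pₘ/m` the normalized power sums for `m ≥ 1`). -/
abbrev Q := MvPolynomial ℕ ℚ

/-- `𝐒ₙᵏ = Σ_α ∏_{i=0}^{n} Qᵢ^{αᵢ}/αᵢ!`, summed over all `(n+1)`-tuples
`α = (α₀,…,αₙ)` of nonnegative integers with `α₀ + ⋯ + αₙ = k` and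
`α₁ + 2α₂ + ⋯ + nαₙ = n`: the component of degree `n` and auxiliary degree `k`
of the series `e^{Σₘ Qₘ}`.  (Such tuples automatically satisfy `αᵢ ≤ k`, so
they form the finite set below.) -/
def Sc (n k : ℕ) : Q :=
  ∑ α ∈ (Fintype.piFinset fun _ : Fin (n + 1) => Finset.range (k + 1)).filter
      (fun α => (∑ i : Fin (n + 1), α i) = k ∧ (∑ i : Fin (n + 1), (i : ℕ) * α i) = n),
    (∏ i : Fin (n + 1), ((α i).factorial : ℚ)⁻¹) •
      ∏ i : Fin (n + 1), (X (i : ℕ) : Q) ^ (α i)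

open PowerSeries in
/-- `k! · 𝐒ₙᵏ` is the coefficient of `tⁿ` in `(Σₘ Qₘ tᵐ)ᵏ`. -/
theorem coeff_mk_X_pow (n k : ℕ) :
    coeff n ((PowerSeries.mk fun m => (MvPolynomial.X m : Q)) ^ k) =
      (k.factorial : ℚ) • Sc n k := by
  set f : PowerSeries Q := PowerSeries.mk fun m => (MvPolynomial.X m : Q) with hf
  have htrunc : ((trunc (n + 1) f : Polynomial Q) : PowerSeries Q) =
      ∑ i : Fin (n + 1), monomial (i : ℕ) (MvPolynomial.X (i : ℕ) : Q) := by
    rw [Fin.sum_univ_eq_sum_range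
      (fun i => monomial i (MvPolynomial.X i : Q)) (n + 1)]
    ext1 j
    simp [coeff_trunc, PowerSeries.coeff_monomial, hf]
  have hcoeff : coeff n (f ^ k) =
      coeff n (((trunc (n + 1) f : Polynomial Q) : PowerSeries Q) ^ k) := by
    have h := congrArg (fun p => Polynomial.coeff p n) (trunc_trunc_pow f (n + 1) k)
    simpa only [coeff_trunc, Nat.lt_succ_self, if_true] using h.symm
  rw [hcoeff, htrunc, Finset.sum_pow_eq_sum_piAntidiag, map_sum, Sc, Finset.smul_sum]
  have hset : ((Fintype.piFinset fun _ : Fin (n + 1) => Finset.range (k + 1)).filter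
      fun α => (∑ i : Fin (n + 1), α i) = k ∧ (∑ i : Fin (n + 1), (i : ℕ) * α i) = n) =
      (Finset.univ.piAntidiag k).filter
        fun α : Fin (n + 1) → ℕ => (∑ i : Fin (n + 1), (i : ℕ) * α i) = n := by
    ext α
    simp only [Finset.mem_filter, Fintype.mem_piFinset, Finset.mem_range,
      Finset.mem_piAntidiag, Finset.mem_univ, implies_true, and_true]
    refine ⟨fun h => h.2, fun h => ⟨fun i => ?_, h⟩⟩
    exact Nat.lt_succ_of_le (h.1 ▸ Finset.single_le_sum (fun _ _ => Nat.zero_le _)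
      (Finset.mem_univ i))
  rw [hset, Finset.sum_filter]
  refine Finset.sum_congr rfl fun α hα => ?_
  have hprod : ∏ i : Fin (n + 1), monomial (i : ℕ) (MvPolynomial.X (i : ℕ) : Q) ^ α i =
      monomial (∑ i : Fin (n + 1), (i : ℕ) * α i)
        (∏ i : Fin (n + 1), (MvPolynomial.X (i : ℕ) : Q) ^ α i) := by
    simp_rw [PowerSeries.monomial_pow, mul_comm (α _), prod_monomial]
  have hmult : (Nat.multinomial Finset.univ α : ℚ) =
      k.factorial * ∏ i : Fin (n + 1), ((α i).factorial : ℚ)⁻¹ := by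
    have hk : ∑ i, α i = k := (Finset.mem_piAntidiag.1 hα).1
    have h := Nat.multinomial_spec Finset.univ α
    rw [hk] at h
    have hne : (∏ i, ((α i).factorial : ℚ)) ≠ 0 :=
      Finset.prod_ne_zero_iff.2 fun i _ => by exact_mod_cast (α i).factorial_ne_zero
    rw [Finset.prod_inv_distrib, eq_mul_inv_iff_mul_eq₀ hne, mul_comm]
    exact_mod_cast h
  rw [hprod, ← nsmul_eq_mul, map_nsmul, PowerSeries.coeff_monomial, ← Nat.cast_smul_eq_nsmul ℚ, hmult]
  split_ifs with h₁ h₂ h₂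
  · rw [mul_smul]
  · exact absurd h₁.symm h₂
  · exact absurd h₂.symm h₁
  · rw [smul_zero]

/-- Proposition 6.1: for all `n, k, l`,
`binom(k+l, k) · 𝐒ₙ^{k+l} = Σ_{m=0}^{n} 𝐒ₘᵏ · 𝐒_{n-m}^{l}`. -/
theorem stmt13 (n k l : ℕ) :
    (((k + l).choose k : ℚ)) • Sc n (k + l) =
      ∑ m ∈ Finset.range (n + 1), Sc m k * Sc (n - m) l := by
  have h := coeff_mk_X_pow n (k + l)
  rw [pow_add, PowerSeries.coeff_mul, Finset.Nat.sum_antidiagonal_eq_sum_range_succ_mk] at h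
  simp only [coeff_mk_X_pow, smul_mul_smul_comm, ← Finset.smul_sum] at h
  have hne : (k.factorial * l.factorial : ℚ) ≠ 0 := by positivity
  have hfac : ((k + l).factorial : ℚ) = (k.factorial * l.factorial) * (k + l).choose k := by
    have := Nat.add_choose_mul_factorial_mul_factorial l k
    rw [add_comm k l, ← this]
    push_cast
    ring
  rw [hfac, mul_smul (_ * _)] at h
  exact (smul_right_injective Q hne h).symm

end
end

section
/- For all natural numbers n, k, the coproduct of 𝐒ₙᵏ is Δ(𝐒ₙᵏ) = Σ_{m=0}^{n} Σ_{i=0}^{k} 𝐒ₘⁱ ⊗ 𝐒_{n−m}^{k−i} in Q ⊗[ℚ] Q. -/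
/-! Statement 15: the coproduct of 𝐒ₙᵏ. -/

open MvPolynomial TensorProduct

noncomputable section

/-- The coproduct on `qSym`: the algebra map with all `Qₘ = X m` primitive. -/
def DeltaQ : Q →ₐ[ℚ] Q ⊗[ℚ] Q :=
  aeval fun m : ℕ => X m ⊗ₜ[ℚ] 1 + 1 ⊗ₜ[ℚ] X m

/-- Exponent tuples indexed by `Fin N` of total degree `k` and weighted degree `n`. -/
def exponents (N n k : ℕ) : Finset (Fin N → ℕ) :=
  (Fintype.piFinset fun _ : Fin N => Finset.range (k + 1)).filter
    (fun α => (∑ i : Fin N, α i) = k ∧ (∑ i : Fin N, (i : ℕ) * α i) = n)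

theorem mem_exponents {N n k : ℕ} {α : Fin N → ℕ} :
    α ∈ exponents N n k ↔ (∑ i, α i) = k ∧ (∑ i : Fin N, (i : ℕ) * α i) = n := by
  simp only [exponents, Finset.mem_filter, Fintype.mem_piFinset, Finset.mem_range,
    and_iff_right_iff_imp]
  rintro ⟨rfl, -⟩ i
  exact Nat.lt_succ_of_le (Finset.single_le_sum (fun _ _ => Nat.zero_le _) (Finset.mem_univ i))

/-- The normalized monomial `∏ xᵢ^{αᵢ}/αᵢ!`. -/
def dividedMonomial {A : Type*} [CommRing A] [Algebra ℚ A] {N : ℕ} (x : Fin N → A)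
    (α : Fin N → ℕ) : A :=
  ∏ i, ((α i).factorial : ℚ)⁻¹ • x i ^ α i

theorem inv_factorial_smul_add_pow {A : Type*} [CommRing A] [Algebra ℚ A] (x y : A) (a : ℕ) :
    ((a.factorial : ℚ)⁻¹) • (x + y) ^ a =
      ∑ p ∈ Finset.HasAntidiagonal.antidiagonal a,
        ((p.1.factorial : ℚ)⁻¹ • x ^ p.1) * ((p.2.factorial : ℚ)⁻¹ • y ^ p.2) := by
  rw [(Commute.all x y).add_pow', Finset.smul_sum]
  refine Finset.sum_congr rfl fun p hp => ?_
  rw [Finset.HasAntidiagonal.mem_antidiagonal] at hp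
  subst hp
  rw [smul_mul_smul_comm, ← Nat.cast_smul_eq_nsmul ℚ, smul_smul]
  congr 1
  rw [Nat.cast_add_choose]
  field_simp

theorem dividedMonomial_add {A : Type*} [CommRing A] [Algebra ℚ A] {N : ℕ} (x y : Fin N → A)
    (α : Fin N → ℕ) :
    dividedMonomial (x + y) α =
      ∑ p ∈ Fintype.piFinset fun i => Finset.HasAntidiagonal.antidiagonal (α i),
        dividedMonomial x (fun i => (p i).1) * dividedMonomial y (fun i => (p i).2) := by
  simp only [dividedMonomial, Pi.add_apply, inv_factorial_smul_add_pow, Finset.prod_univ_sum,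
    Finset.prod_mul_distrib]

theorem map_dividedMonomial {A B : Type*} [CommRing A] [Algebra ℚ A] [CommRing B] [Algebra ℚ B]
    (f : A →ₐ[ℚ] B) {N : ℕ} (x : Fin N → A) (α : Fin N → ℕ) :
    f (dividedMonomial x α) = dividedMonomial (fun i => f (x i)) α := by
  simp [dividedMonomial, map_prod, map_smul]

theorem sum_exponents_succ {n N : ℕ} (h : n < N) (k : ℕ) :
    ∑ α ∈ exponents (N + 1) n k, dividedMonomial (fun i => (X (i : ℕ) : Q)) α =
      ∑ α ∈ exponents N n k, dividedMonomial (fun i => (X (i : ℕ) : Q)) α := by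
  have last_eq_zero : ∀ α ∈ exponents (N + 1) n k, α (Fin.last N) = 0 := by
    intro α hα
    have hw := (mem_exponents.1 hα).2
    rw [Fin.sum_univ_castSucc, Fin.val_last] at hw
    by_contra h0
    have := Nat.le_mul_of_pos_right N (Nat.pos_of_ne_zero h0)
    omega
  symm
  refine Finset.sum_bij' (fun α _ => (Fin.snoc α 0 : Fin (N + 1) → ℕ)) (fun α _ => Fin.init α)
    ?_ ?_ ?_ ?_ ?_
  · intro α hα
    simpa [mem_exponents, Fin.sum_univ_castSucc] using mem_exponents.1 hα
  · intro α hα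
    simpa [mem_exponents, Fin.sum_univ_castSucc, last_eq_zero α hα, Fin.init]
      using mem_exponents.1 hα
  · intro α _
    simp
  · intro α hα
    rw [← last_eq_zero α hα, Fin.snoc_init_self]
  · intro α _
    simp [dividedMonomial, Fin.prod_univ_castSucc]

theorem Sc_eq_sum_exponents {n N : ℕ} (h : n < N) (k : ℕ) :
    Sc n k = ∑ α ∈ exponents N n k, dividedMonomial (fun i => (X (i : ℕ) : Q)) α := by
  induction N, h using Nat.le_induction with
  | base =>
    simp only [dividedMonomial, Finset.prod_smul]
    rfl
  | succ N h ih => rw [ih, sum_exponents_succ h]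

theorem sum_exponents_antidiagonal {M : Type*} [AddCommMonoid M] (N n k : ℕ)
    (F : (Fin N → ℕ) → (Fin N → ℕ) → M) :
    ∑ α ∈ exponents N n k, ∑ p ∈ Fintype.piFinset fun i => Finset.HasAntidiagonal.antidiagonal (α i),
        F (fun i => (p i).1) (fun i => (p i).2) =
      ∑ m ∈ Finset.range (n + 1), ∑ i ∈ Finset.range (k + 1),
        ∑ β ∈ exponents N m i, ∑ γ ∈ exponents N (n - m) (k - i), F β γ := by
  simp only [Finset.sum_sigma']
  refine Finset.sum_bij'
    (fun q _ => ⟨∑ i : Fin N, (i : ℕ) * (q.2 i).1, ∑ i, (q.2 i).1, fun i => (q.2 i).1,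
      fun i => (q.2 i).2⟩)
    (fun q _ => ⟨fun i => q.2.2.1 i + q.2.2.2 i, fun i => (q.2.2.1 i, q.2.2.2 i)⟩) ?_ ?_ ?_ ?_ ?_
  · rintro ⟨α, p⟩ h
    simp only [Finset.mem_sigma, mem_exponents, Fintype.mem_piFinset,
      Finset.HasAntidiagonal.mem_antidiagonal, Finset.mem_range] at h ⊢
    obtain ⟨⟨rfl, rfl⟩, h⟩ := h
    simp only [← h, mul_add, Finset.sum_add_distrib]
    simp
  · rintro ⟨m, i, β, γ⟩ h
    simp only [Finset.mem_sigma, mem_exponents, Fintype.mem_piFinset,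
      Finset.HasAntidiagonal.mem_antidiagonal, Finset.mem_range, mul_add,
      Finset.sum_add_distrib] at h ⊢
    simp
    omega
  · rintro ⟨α, p⟩ h
    simp only [Finset.mem_sigma, Fintype.mem_piFinset, Finset.HasAntidiagonal.mem_antidiagonal] at h
    simp [h.2]
  · rintro ⟨m, i, β, γ⟩ h
    simp only [Finset.mem_sigma, mem_exponents] at h
    simp [h.2.2.1]
  · intros
    rfl

/-- Proposition 6.2 (first part): `Δ(𝐒ₙᵏ) = Σ_{m=0}^{n} Σ_{i=0}^{k} 𝐒ₘⁱ ⊗ 𝐒_{n-m}^{k-i}`. -/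
theorem stmt15 (n k : ℕ) :
    DeltaQ (Sc n k) =
      ∑ m ∈ Finset.range (n + 1), ∑ i ∈ Finset.range (k + 1),
        Sc m i ⊗ₜ[ℚ] Sc (n - m) (k - i) := by
  have hΔ (α : Fin (n + 1) → ℕ) :
      DeltaQ (dividedMonomial (fun i => (X (i : ℕ) : Q)) α) =
        ∑ p ∈ Fintype.piFinset fun i => Finset.HasAntidiagonal.antidiagonal (α i),
          dividedMonomial (fun i => (X (i : ℕ) : Q)) (fun i => (p i).1) ⊗ₜ[ℚ]
            dividedMonomial (fun i => (X (i : ℕ) : Q)) (fun i => (p i).2) := by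
    have hX : (fun i : Fin (n + 1) => DeltaQ (X (i : ℕ))) =
        (fun i : Fin (n + 1) =>
            (Algebra.TensorProduct.includeLeft : Q →ₐ[ℚ] Q ⊗[ℚ] Q) (X (i : ℕ))) +
          fun i : Fin (n + 1) =>
            (Algebra.TensorProduct.includeRight : Q →ₐ[ℚ] Q ⊗[ℚ] Q) (X (i : ℕ)) := by
      funext i
      simp [DeltaQ]
    rw [map_dividedMonomial, hX, dividedMonomial_add]
    refine Finset.sum_congr rfl fun p _ => ?_
    rw [← map_dividedMonomial, ← map_dividedMonomial, Algebra.TensorProduct.includeLeft_apply,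
      Algebra.TensorProduct.includeRight_apply, Algebra.TensorProduct.tmul_mul_tmul, mul_one,
      one_mul]
  rw [Sc_eq_sum_exponents n.lt_succ_self, map_sum]
  simp only [hΔ]
  rw [sum_exponents_antidiagonal (n + 1) n k fun β γ =>
    dividedMonomial (fun i => (X (i : ℕ) : Q)) β ⊗ₜ[ℚ] dividedMonomial (fun i => (X (i : ℕ) : Q)) γ]
  refine Finset.sum_congr rfl fun m hm => Finset.sum_congr rfl fun i _ => ?_
  rw [Sc_eq_sum_exponents (Finset.mem_range.1 hm),
    Sc_eq_sum_exponents (Nat.lt_succ_of_le (Nat.sub_le n m)), TensorProduct.sum_tmul]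
  simp only [TensorProduct.tmul_sum]

end
end

section
/- For all natural numbers n, k and all p ≥ 1, the iterated coproduct of 𝐒ₙᵏ is Δ^{p−1}(𝐒ₙᵏ) = Σ 𝐒_{n₁}^{k₁} ⊗ ⋯ ⊗ 𝐒_{n_p}^{k_p}, where the sum runs over all p-tuples of natural numbers (n₁,…,n_p) with n₁+⋯+n_p = n and all p-tuples (k₁,…,k_p) with k₁+⋯+k_p = k. -/
/-! Statement 16: the iterated coproduct of 𝐒ₙᵏ. -/

open MvPolynomial TensorProduct

noncomputable section

/-- Model of the `p`-fold tensor power `Q^{⊗p}`: the `j`-th tensor factor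
corresponds to the variables `X (m, j)`. -/
abbrev Qpow (p : ℕ) := MvPolynomial (ℕ × Fin p) ℚ

/-- The iterated coproduct `Δ^{p-1} : Q → Q^{⊗p}` (with `p` tensor factors) of
the coproduct making all `Qₘ = X m` primitive: the algebra map sending `X m`
to the sum of its copies in the `p` slots. -/
def DIterQ (p : ℕ) : Q →ₐ[ℚ] Qpow p :=
  aeval fun m : ℕ => ∑ j : Fin p, X (m, j)

open Finset in
/-- The divided-power form of the multinomial theorem. -/
theorem inv_factorial_smul_sum_pow {A ι : Type*} [CommRing A] [Algebra ℚ A] [DecidableEq ι]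
    (s : Finset ι) (y : ι → A) (a : ℕ) :
    (a.factorial : ℚ)⁻¹ • (∑ j ∈ s, y j) ^ a =
      ∑ β ∈ s.piAntidiag a, ∏ j ∈ s, ((β j).factorial : ℚ)⁻¹ • y j ^ β j := by
  rw [sum_pow_eq_sum_piAntidiag, smul_sum]
  refine sum_congr rfl fun β hβ => ?_
  have hspec := Nat.multinomial_spec s β
  rw [(mem_piAntidiag.1 hβ).1] at hspec
  rw [prod_smul, ← nsmul_eq_mul, ← Nat.cast_smul_eq_nsmul ℚ, smul_smul, ← hspec]
  congr 1
  have hne : (∏ j ∈ s, ((β j).factorial : ℚ)) ≠ 0 :=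
    prod_ne_zero_iff.2 fun j _ => by positivity
  have hm : (Nat.multinomial s β : ℚ) ≠ 0 := by
    exact_mod_cast (Nat.multinomial_pos s β).ne'
  push_cast
  rw [prod_inv_distrib]
  field_simp

/-- The exponents `α₀, …, α_N` with `∑ αᵢ = k` and `∑ i αᵢ = n`. -/
def expSet (N n k : ℕ) : Finset (Fin (N + 1) → ℕ) :=
  (Fintype.piFinset fun _ : Fin (N + 1) => Finset.range (k + 1)).filter
    (fun α => (∑ i : Fin (N + 1), α i) = k ∧ (∑ i : Fin (N + 1), (i : ℕ) * α i) = n)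

theorem mem_expSet {N n k : ℕ} {α : Fin (N + 1) → ℕ} :
    α ∈ expSet N n k ↔
      (∑ i : Fin (N + 1), α i) = k ∧ (∑ i : Fin (N + 1), (i : ℕ) * α i) = n := by
  simp only [expSet, Finset.mem_filter, Fintype.mem_piFinset, Finset.mem_range,
    and_iff_right_iff_imp]
  rintro ⟨rfl, -⟩ i
  exact Nat.lt_succ_of_le (Finset.single_le_sum (fun _ _ => Nat.zero_le _) (Finset.mem_univ i))

/-- The component of degree `n` and auxiliary degree `k` of `exp (x₀ + ⋯ + x_N)`. -/
def expComponent {A : Type*} [CommRing A] [Algebra ℚ A] (x : ℕ → A) (N n k : ℕ) : A :=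
  ∑ α ∈ expSet N n k, ∏ i : Fin (N + 1), ((α i).factorial : ℚ)⁻¹ • x i ^ α i

theorem map_Sc {A : Type*} [CommRing A] [Algebra ℚ A] (f : Q →ₐ[ℚ] A) (n k : ℕ) :
    f (Sc n k) = expComponent (fun m => f (X m)) n n k := by
  simp only [Sc, expComponent, expSet, map_sum, map_smul, map_prod, map_pow, Finset.prod_smul]

theorem expComponent_succ {A : Type*} [CommRing A] [Algebra ℚ A] (x : ℕ → A) {N n : ℕ}
    (h : n ≤ N) (k : ℕ) : expComponent x (N + 1) n k = expComponent x N n k := by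
  have hlast : ∀ α ∈ expSet (N + 1) n k, α (Fin.last (N + 1)) = 0 := by
    intro α hα
    have hw := (mem_expSet.1 hα).2
    rw [Fin.sum_univ_castSucc, Fin.val_last] at hw
    by_contra h0
    have := Nat.le_mul_of_pos_right (N + 1) (Nat.pos_of_ne_zero h0)
    omega
  refine Finset.sum_bij' (fun α _ => Fin.init α)
    (fun α _ => Fin.snoc (α := fun _ => ℕ) α 0) ?_ ?_ ?_ ?_ ?_
  · intro α hα
    have h0 := hlast α hα
    rw [mem_expSet] at hα ⊢
    simpa [Fin.sum_univ_castSucc (n := N + 1), h0, Fin.init] using hα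
  · intro α hα
    rw [mem_expSet] at hα ⊢
    simpa [Fin.sum_univ_castSucc (n := N + 1)] using hα
  · intro α hα
    rw [← hlast α hα, Fin.snoc_init_self]
  · intro α _
    exact Fin.init_snoc _ _
  · intro α hα
    simp [Fin.prod_univ_castSucc (n := N + 1), hlast α hα, Fin.init]

theorem expComponent_eq_of_le {A : Type*} [CommRing A] [Algebra ℚ A] (x : ℕ → A) {N n : ℕ}
    (h : n ≤ N) (k : ℕ) : expComponent x N n k = expComponent x n n k := by
  induction N, h using Nat.le_induction with
  | base => rfl
  | succ N hN ih => rw [expComponent_succ x hN, ih]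

/-- The exponent matrices, with rows in `ι`, of total auxiliary degree `k` and degree `n`. -/
def expMatrices (ι : Type*) [Fintype ι] [DecidableEq ι] (N n k : ℕ) :
    Finset (ι → Fin (N + 1) → ℕ) :=
  (Fintype.piFinset fun _ : ι => Fintype.piFinset fun _ : Fin (N + 1) =>
    Finset.range (k + 1)).filter
    (fun β => (∑ j, ∑ i, β j i) = k ∧ (∑ j, ∑ i : Fin (N + 1), (i : ℕ) * β j i) = n)

theorem mem_expMatrices {ι : Type*} [Fintype ι] [DecidableEq ι] {N n k : ℕ}
    {β : ι → Fin (N + 1) → ℕ} :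
    β ∈ expMatrices ι N n k ↔
      (∑ j, ∑ i, β j i) = k ∧ (∑ j, ∑ i : Fin (N + 1), (i : ℕ) * β j i) = n := by
  simp only [expMatrices, Finset.mem_filter, Fintype.mem_piFinset, Finset.mem_range,
    and_iff_right_iff_imp]
  rintro ⟨rfl, -⟩ j i
  exact Nat.lt_succ_of_le <|
    (Finset.single_le_sum (f := β j) (fun _ _ => Nat.zero_le _) (Finset.mem_univ i)).trans
      (Finset.single_le_sum (f := fun j => ∑ i, β j i) (fun _ _ => Nat.zero_le _)
        (Finset.mem_univ j))

theorem expComponent_sum_eq_sum_expMatrices {A ι : Type*} [CommRing A] [Algebra ℚ A] [Fintype ι]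
    [DecidableEq ι] (x : ι → ℕ → A) (N n k : ℕ) :
    expComponent (fun m => ∑ j, x j m) N n k =
      ∑ β ∈ expMatrices ι N n k, ∏ j, ∏ i, ((β j i).factorial : ℚ)⁻¹ • x j i ^ β j i := by
  simp only [expComponent, inv_factorial_smul_sum_pow, Finset.prod_univ_sum]
  rw [← Finset.sum_fiberwise_of_maps_to (s := expMatrices ι N n k) (t := expSet N n k)
    (g := fun β i => ∑ j, β j i)]
  · refine Finset.sum_congr rfl fun α hα => ?_
    refine Finset.sum_equiv (Equiv.piComm _) (fun γ => ?_) fun γ _ => Finset.prod_comm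
    rw [mem_expSet] at hα
    simp only [Fintype.mem_piFinset, Finset.mem_piAntidiag, Finset.mem_univ, implies_true,
      and_true, Finset.mem_filter, mem_expMatrices, Equiv.piComm_apply, Function.swap, funext_iff]
    refine ⟨fun hγ => ⟨⟨?_, ?_⟩, hγ⟩, And.right⟩
    · rw [Finset.sum_comm]
      simpa only [hγ] using hα.1
    · rw [Finset.sum_comm]
      simpa only [← Finset.mul_sum, hγ] using hα.2
  · intro β hβ
    rw [mem_expMatrices] at hβ
    rw [mem_expSet]
    simp only [Finset.mul_sum]
    rwa [Finset.sum_comm, Finset.sum_comm (f := fun (i : Fin (N + 1)) j => (i : ℕ) * β j i)]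

theorem mem_filter_piFinset_range_sum {ι : Type*} [Fintype ι] [DecidableEq ι] {n : ℕ}
    {f : ι → ℕ} :
    f ∈ (Fintype.piFinset fun _ : ι => Finset.range (n + 1)).filter (fun f => ∑ j, f j = n) ↔
      ∑ j, f j = n := by
  simp only [Finset.mem_filter, Fintype.mem_piFinset, Finset.mem_range, and_iff_right_iff_imp]
  rintro rfl j
  exact Nat.lt_succ_of_le (Finset.single_le_sum (fun _ _ => Nat.zero_le _) (Finset.mem_univ j))

theorem expComponent_sum {A ι : Type*} [CommRing A] [Algebra ℚ A] [Fintype ι]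
    [DecidableEq ι] (x : ι → ℕ → A) (N n k : ℕ) :
    expComponent (fun m => ∑ j, x j m) N n k =
      ∑ ns ∈ (Fintype.piFinset fun _ : ι => Finset.range (n + 1)).filter
          (fun ns => ∑ j, ns j = n),
        ∑ ks ∈ (Fintype.piFinset fun _ : ι => Finset.range (k + 1)).filter
            (fun ks => ∑ j, ks j = k),
          ∏ j, expComponent (x j) N (ns j) (ks j) := by
  rw [expComponent_sum_eq_sum_expMatrices, ← Finset.sum_product',
    ← Finset.sum_fiberwise_of_maps_to (s := expMatrices ι N n k)
      (g := fun β => (fun j => ∑ i : Fin (N + 1), (i : ℕ) * β j i, fun j => ∑ i, β j i))]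
  · refine Finset.sum_congr rfl fun d hd => ?_
    rw [Finset.mem_product, mem_filter_piFinset_range_sum, mem_filter_piFinset_range_sum] at hd
    simp only [expComponent, Finset.prod_univ_sum]
    refine Finset.sum_congr ?_ fun _ _ => rfl
    ext β
    simp only [Finset.mem_filter, mem_expMatrices, Fintype.mem_piFinset, mem_expSet,
      Prod.ext_iff, funext_iff, forall_and]
    refine ⟨fun h => h.2.symm, fun h => ⟨?_, h.symm⟩⟩
    simpa only [h.1, h.2] using hd.symm
  · intro β hβ
    rw [mem_expMatrices] at hβ
    rw [Finset.mem_product, mem_filter_piFinset_range_sum, mem_filter_piFinset_range_sum]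
    exact hβ.symm

/-- Proposition 6.2 (second part): for `p ≥ 1`,
`Δ^{p-1}(𝐒ₙᵏ) = Σ_{n₁+⋯+n_p = n} Σ_{k₁+⋯+k_p = k} 𝐒_{n₁}^{k₁} ⊗ ⋯ ⊗ 𝐒_{n_p}^{k_p}`;
in the model `Qpow p` the `j`-th tensor factor `𝐒_{n_j}^{k_j}` is the renaming
of `𝐒_{n_j}^{k_j}` into the slot-`j` variables, and the tensor is their product. -/
theorem stmt16 (n k p : ℕ) (hp : 1 ≤ p) :
    DIterQ p (Sc n k) =
      ∑ ns ∈ (Fintype.piFinset fun _ : Fin p => Finset.range (n + 1)).filter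
          (fun ns => ∑ j : Fin p, ns j = n),
        ∑ ks ∈ (Fintype.piFinset fun _ : Fin p => Finset.range (k + 1)).filter
            (fun ks => ∑ j : Fin p, ks j = k),
          ∏ j : Fin p, rename (fun m : ℕ => (m, j)) (Sc (ns j) (ks j)) := by
  rw [map_Sc]
  simp only [DIterQ, aeval_X]
  rw [expComponent_sum (fun (j : Fin p) m => (X (m, j) : Qpow p))]
  refine Finset.sum_congr rfl fun ns hns => Finset.sum_congr rfl fun ks _ =>
    Finset.prod_congr rfl fun j _ => ?_
  have hle : ns j ≤ n := Nat.le_of_lt_succ <| Finset.mem_range.1 <|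
    Fintype.mem_piFinset.1 (Finset.mem_filter.1 hns).1 j
  simp only [map_Sc, rename_X, expComponent_eq_of_le _ hle]


end
end
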